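/- arXiv:1511.05767 — 2 statements merged into one kernel-verified Lean document; each statement's English description precedes it below -/
import Mathlib

section
/- Let n ≥ 3 and let (S, 𝒜, ℛ) be a Schottky system. Suppose δ ≥ ε > 0, p is a rational point of ℙ contained in a rational projective hyperplane L, and [p]_ε ∩ ℛ = ∅ and [L]_δ ∩ 𝒜 = ∅. Then there exists a rank-1 unipotent v ∈ SL(n,ℤ) with p_v = p and L_v = L such that (S ∪ {v}, 𝒜 ∪ [p]_ε, ℛ ∪ [L]_δ) is a Schottky system containing (S, 𝒜, ℛ). -/
/- Common setup: `SL(n,ℤ)`, `SL(n,ℝ)`, the real projective space `ℙ^{n-1}(ℝ)`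
with its quotient topology and the projective action, rank-1 unipotent elements
and their attracting points / fixed hyperplanes, metrics compatible with the
topology of `ℙ`, `ε`-neighbourhoods, Schottky systems, profinite density,
maximal subgroups, and lattices in `SL(n,ℝ)`. -/

open Matrix LinearAlgebra.Projectivization

abbrev SLZ (n : ℕ) := Matrix.SpecialLinearGroup (Fin n) ℤ

abbrev SLR (n : ℕ) := Matrix.SpecialLinearGroup (Fin n) ℝ

/-- The real projective space `ℙ^{n-1}(ℝ)`: the projectivization of `ℝⁿ`. -/
abbrev Proj (n : ℕ) := Projectivization ℝ (Fin n → ℝ)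

/-- The quotient topology on `ℙ^{n-1}(ℝ)`. -/
noncomputable instance (n : ℕ) : TopologicalSpace (Proj n) :=
  inferInstanceAs (TopologicalSpace (Quotient _))

/-- The action of `SL(n,ℝ)` on `ℙ^{n-1}(ℝ)` induced by the linear action on `ℝⁿ`. -/
noncomputable def actR {n : ℕ} (g : SLR n) (x : Proj n) : Proj n :=
  Projectivization.map (Matrix.SpecialLinearGroup.toLin' g).toLinearMap
    (Matrix.SpecialLinearGroup.toLin' g).injective x

/-- The action of `SL(n,ℤ)` on `ℙ^{n-1}(ℝ)` induced by the linear action on `ℝⁿ`. -/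
noncomputable def act {n : ℕ} (g : SLZ n) (x : Proj n) : Proj n :=
  actR (Matrix.SpecialLinearGroup.map (Int.castRingHom ℝ) g) x

/-- The real matrix attached to `g ∈ SL(n,ℤ)`. -/
noncomputable def matR {n : ℕ} (g : SLZ n) : Matrix (Fin n) (Fin n) ℝ :=
  ((Matrix.SpecialLinearGroup.map (Int.castRingHom ℝ)) g : Matrix (Fin n) (Fin n) ℝ)

/-- The subspace `Im(u - I) ⊆ ℝⁿ` (a line when `u` is rank-1 unipotent). -/
noncomputable def lineOf {n : ℕ} (u : SLZ n) : Submodule ℝ (Fin n → ℝ) :=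
  LinearMap.range (Matrix.mulVecLin (matR u - 1))

/-- The subspace `ker(u - I) ⊆ ℝⁿ` (a hyperplane when `u` is rank-1 unipotent). -/
noncomputable def hypOf {n : ℕ} (u : SLZ n) : Submodule ℝ (Fin n → ℝ) :=
  LinearMap.ker (Matrix.mulVecLin (matR u - 1))

/-- The rational matrix attached to `g ∈ SL(n,ℤ)`. -/
noncomputable def matQ {n : ℕ} (g : SLZ n) : Matrix (Fin n) (Fin n) ℚ :=
  ((Matrix.SpecialLinearGroup.map (Int.castRingHom ℚ)) g : Matrix (Fin n) (Fin n) ℚ)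

/-- `g - I`, as a `ℚ`-linear endomorphism of `ℚⁿ`. -/
noncomputable def linQ {n : ℕ} (g : SLZ n) : (Fin n → ℚ) →ₗ[ℚ] (Fin n → ℚ) :=
  Matrix.mulVecLin (matQ g - 1)

/-- `u` is a rank-1 unipotent element of `SL(n,ℤ)`: `u - I` is nilpotent of rank one. -/
def IsR1U {n : ℕ} (u : SLZ n) : Prop :=
  IsNilpotent (linQ u) ∧ Module.finrank ℚ (LinearMap.range (linQ u)) = 1

/-- The point of attraction `p_u` of `u`, as a subset of `ℙ` (a singleton when `u` is a
rank-1 unipotent): the projective points whose representative spans `Im(u - I)`. -/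
def attSet {n : ℕ} (u : SLZ n) : Set (Proj n) :=
  {x | x.submodule = lineOf u}

/-- The fixed hyperplane `L_u` of `u`, as a subset of `ℙ`. -/
def fixSet {n : ℕ} (u : SLZ n) : Set (Proj n) :=
  {x | x.submodule ≤ hypOf u}

/-- The subset of `ℙ` corresponding to a linear subspace `W ⊆ ℝⁿ`. -/
def projSet {n : ℕ} (W : Submodule ℝ (Fin n → ℝ)) : Set (Proj n) :=
  {x | x.submodule ≤ W}

/-- The image `g • W` of a subspace of `ℝⁿ` under `g ∈ SL(n,ℤ)`. -/
noncomputable def actSub {n : ℕ} (g : SLZ n) (W : Submodule ℝ (Fin n → ℝ)) :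
    Submodule ℝ (Fin n → ℝ) :=
  Submodule.map (Matrix.mulVecLin (matR g)) W

/-- The image `g • W` of a subspace of `ℝⁿ` under `g ∈ SL(n,ℝ)`. -/
noncomputable def actSubR {n : ℕ} (g : SLR n) (W : Submodule ℝ (Fin n → ℝ)) :
    Submodule ℝ (Fin n → ℝ) :=
  Submodule.map (Matrix.mulVecLin (g : Matrix (Fin n) (Fin n) ℝ)) W

/-- `d` is a metric on `ℙ^{n-1}(ℝ)` inducing the quotient topology. -/
structure IsCompatMetric {n : ℕ} (d : Proj n → Proj n → ℝ) : Prop where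
  self : ∀ x, d x x = 0
  eq_of : ∀ x y, d x y = 0 → x = y
  symm : ∀ x y, d x y = d y x
  triangle : ∀ x y z, d x z ≤ d x y + d y z
  inducing : ∀ s : Set (Proj n), IsOpen s ↔ ∀ x ∈ s, ∃ ε > 0, ∀ y, d x y < ε → y ∈ s

/-- The distance from a point to a set. -/
noncomputable def setDist {n : ℕ} (d : Proj n → Proj n → ℝ) (x : Proj n)
    (A : Set (Proj n)) : ℝ :=
  sInf (d x '' A)

/-- The open `ε`-neighbourhood `(A)_ε = {x | dist(x, A) < ε}`. -/
def oThick {n : ℕ} (d : Proj n → Proj n → ℝ) (A : Set (Proj n)) (ε : ℝ) : Set (Proj n) :=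
  {x | setDist d x A < ε}

/-- The closed `ε`-neighbourhood `[A]_ε = {x | dist(x, A) ≤ ε}`. -/
def cThick {n : ℕ} (d : Proj n → Proj n → ℝ) (A : Set (Proj n)) (ε : ℝ) : Set (Proj n) :=
  {x | setDist d x A ≤ ε}

/-- The Hausdorff distance between two subsets of `ℙ`. -/
noncomputable def hDist {n : ℕ} (d : Proj n → Proj n → ℝ) (A B : Set (Proj n)) : ℝ :=
  max (sSup ((fun a => setDist d a B) '' A)) (sSup ((fun b => setDist d b A) '' B))

/-- A rational point of `ℙ`: one spanned by a vector of `ℚⁿ`. -/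
def RatPoint {n : ℕ} (p : Proj n) : Prop :=
  ∃ v : Fin n → ℚ, p.submodule = Submodule.span ℝ {fun i => ((v i : ℝ))}

/-- A subspace of `ℝⁿ` spanned by vectors of `ℚⁿ`. -/
def IsRatSubmodule {n : ℕ} (W : Submodule ℝ (Fin n → ℝ)) : Prop :=
  ∃ T : Set (Fin n → ℚ),
    W = Submodule.span ℝ ((fun (v : Fin n → ℚ) (i : Fin n) => ((v i : ℝ))) '' T)

/-- A Schottky system `(S, 𝒜, ℛ)` with respect to the metric `d`: `S` is a nonempty
set of rank-1 unipotents, `𝒜 ⊆ ℛ` are closed, and for each `u ∈ S` there are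
`δ_u ≥ ε_u > 0` satisfying the ping-pong conditions. -/
structure IsSchottky {n : ℕ} (d : Proj n → Proj n → ℝ) (S : Set (SLZ n))
    (A R : Set (Proj n)) : Prop where
  nonempty : S.Nonempty
  unip : ∀ u ∈ S, IsR1U u
  AsubR : A ⊆ R
  closedA : IsClosed A
  closedR : IsClosed R
  cond : ∃ ε δ : SLZ n → ℝ, (∀ u ∈ S, 0 < ε u ∧ ε u ≤ δ u) ∧
    (∀ u ∈ S, ∀ k : ℤ, k ≠ 0 → ∀ x, x ∉ oThick d (fixSet u) (δ u) →
      act (u ^ k) x ∈ oThick d (attSet u) (ε u)) ∧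
    (∀ u ∈ S, ∀ v ∈ S, u ≠ v → oThick d (attSet u) (ε u) ∩ oThick d (fixSet v) (δ v) = ∅) ∧
    (∀ u ∈ S, oThick d (attSet u) (ε u) ⊆ A) ∧
    (∀ u ∈ S, oThick d (fixSet u) (δ u) ⊆ R)

/-- `H` is profinitely dense in `G`: `HN = G` for every finite-index normal `N ⊴ G`. -/
def ProfinitelyDense {G : Type*} [Group G] (H : Subgroup G) : Prop :=
  ∀ N : Subgroup G, N.Normal → N.FiniteIndex → H ⊔ N = ⊤

/-- `M` is a maximal (proper) subgroup of `G`. -/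
def IsMaxSubgroup {G : Type*} [Group G] (M : Subgroup G) : Prop :=
  M ≠ ⊤ ∧ ∀ K : Subgroup G, M < K → K = ⊤

noncomputable instance (n : ℕ) : TopologicalSpace (SLR n) :=
  inferInstanceAs (TopologicalSpace {A : Matrix (Fin n) (Fin n) ℝ // A.det = 1})

noncomputable instance (n : ℕ) : MeasurableSpace (SLR n) := borel _

/-- `Γ ≤ SL(n,ℝ)` is a lattice: a discrete subgroup admitting a Borel fundamental
domain of finite Haar measure. -/
def IsLatticeIn {n : ℕ} (Γ : Subgroup (SLR n)) : Prop :=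
  DiscreteTopology Γ ∧
  ∃ μ : MeasureTheory.Measure (SLR n), μ.IsHaarMeasure ∧
    ∃ D : Set (SLR n), MeasurableSet D ∧ μ D < ⊤ ∧
      ∀ g : SLR n, ∃! γ : Γ, (γ : SLR n)⁻¹ * g ∈ D

section Metric

variable {n : ℕ} {d : Proj n → Proj n → ℝ}

lemma IsCompatMetric.nonneg (hd : IsCompatMetric d) (x y : Proj n) : 0 ≤ d x y := by
  have h := hd.triangle x y x
  rw [hd.self, hd.symm y x] at h
  linarith

lemma IsCompatMetric.setDist_le (hd : IsCompatMetric d) {A : Set (Proj n)} {a : Proj n}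
    (ha : a ∈ A) (x : Proj n) : setDist d x A ≤ d x a :=
  csInf_le ⟨0, by rintro _ ⟨y, -, rfl⟩; exact hd.nonneg x y⟩ ⟨a, ha, rfl⟩

lemma setDist_singleton (x p : Proj n) : setDist d x {p} = d x p := by
  simp [setDist]

lemma IsCompatMetric.setDist_le_add (hd : IsCompatMetric d) {A : Set (Proj n)}
    (hA : A.Nonempty) (x y : Proj n) : setDist d x A ≤ d x y + setDist d y A := by
  have h : setDist d x A - d x y ≤ setDist d y A := by
    refine le_csInf (hA.image _) ?_
    rintro _ ⟨a, ha, rfl⟩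
    linarith [hd.setDist_le ha x, hd.triangle x y a]
  linarith

lemma IsCompatMetric.isOpen_oThick (hd : IsCompatMetric d) {A : Set (Proj n)}
    (hA : A.Nonempty) (ε : ℝ) : IsOpen (oThick d A ε) := by
  rw [hd.inducing]
  intro x hx
  have hx' : setDist d x A < ε := hx
  refine ⟨ε - setDist d x A, by linarith, fun y hy => ?_⟩
  have := hd.setDist_le_add hA y x
  rw [hd.symm y x] at this
  change setDist d y A < ε
  linarith

lemma IsCompatMetric.isClosed_cThick (hd : IsCompatMetric d) {A : Set (Proj n)}
    (hA : A.Nonempty) (ε : ℝ) : IsClosed (cThick d A ε) := by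
  rw [← isOpen_compl_iff, hd.inducing]
  intro x hx
  have hx' : ε < setDist d x A := not_le.mp hx
  refine ⟨setDist d x A - ε, by linarith, fun y hy => ?_⟩
  have := hd.setDist_le_add hA x y
  change ¬ setDist d y A ≤ ε
  linarith

lemma oThick_subset_cThick (A : Set (Proj n)) (ε : ℝ) : oThick d A ε ⊆ cThick d A ε :=
  fun x (hx : setDist d x A < ε) => hx.le

lemma IsCompatMetric.subset_oThick (hd : IsCompatMetric d) (A : Set (Proj n)) {ε : ℝ}
    (hε : 0 < ε) : A ⊆ oThick d A ε := fun x hx =>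
  (hd.setDist_le hx x).trans_lt (by rwa [hd.self])

/-- The cone over an open subset of projective space is open. -/
lemma isOpen_cone {U : Set (Proj n)} (hU : IsOpen U) :
    IsOpen {y : Fin n → ℝ | ∃ h : y ≠ 0, Projectivization.mk ℝ y h ∈ U} := by
  have hpre : IsOpen ((fun y : {y : Fin n → ℝ // y ≠ 0} => Projectivization.mk ℝ y.1 y.2) ⁻¹' U) :=
    hU
  have himg := (isOpen_compl_singleton (x := (0 : Fin n → ℝ))).isOpenMap_subtype_val _ hpre
  convert himg using 1
  ext y
  constructor
  · rintro ⟨h, hy⟩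
    exact ⟨⟨y, h⟩, hy, rfl⟩
  · rintro ⟨⟨z, h⟩, hz, rfl⟩
    exact ⟨h, hz⟩

end Metric

section Transvection

variable {n : ℕ}

/-- The transvection `x ↦ x + a φ(x) w`, for integral `w`, `φ` with `φ(w) = 0`. -/
def transv (w φ : Fin n → ℤ) (h : φ ⬝ᵥ w = 0) (a : ℤ) : SLZ n :=
  ⟨1 + vecMulVec (a • w) φ, by
    rw [vecMulVec_eq Unit, det_one_add_replicateCol_mul_replicateRow, dotProduct_smul, h,
      smul_zero, add_zero]⟩

lemma transv_add (w φ : Fin n → ℤ) (h : φ ⬝ᵥ w = 0) (a b : ℤ) :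
    transv w φ h (a + b) = transv w φ h a * transv w φ h b := by
  apply Subtype.ext
  change (1 + vecMulVec ((a + b) • w) φ : Matrix (Fin n) (Fin n) ℤ) =
    (1 + vecMulVec (a • w) φ) * (1 + vecMulVec (b • w) φ)
  have h0 : vecMulVec (a • w) φ * vecMulVec (b • w) φ = 0 := by
    rw [vecMulVec_mul_vecMulVec, dotProduct_smul, h, smul_zero, zero_smul, vecMulVec_zero]
  rw [add_mul, mul_add, mul_add, h0, add_smul, add_vecMulVec]
  simp only [mul_one, one_mul, add_zero]
  abel

lemma transv_zpow (w φ : Fin n → ℤ) (h : φ ⬝ᵥ w = 0) (a k : ℤ) :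
    transv w φ h a ^ k = transv w φ h (a * k) := by
  let f : Multiplicative ℤ →* SLZ n := MonoidHom.mk' (fun a => transv w φ h a.toAdd)
    (fun a b => transv_add w φ h a.toAdd b.toAdd)
  have := map_zpow f (Multiplicative.ofAdd a) k
  rw [← ofAdd_zsmul, smul_eq_mul, mul_comm] at this
  exact this.symm

lemma map_transv_sub_one {K : Type*} [Field K] (w φ : Fin n → ℤ) (h : φ ⬝ᵥ w = 0) (a : ℤ) :
    ((SpecialLinearGroup.map (Int.castRingHom K) (transv w φ h a) : SpecialLinearGroup (Fin n) K) :
      Matrix (Fin n) (Fin n) K) - 1 =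
      vecMulVec ((a : K) • fun i => (w i : K)) (fun i => (φ i : K)) := by
  ext i j
  change (((1 : Matrix (Fin n) (Fin n) ℤ) i j + a • w i * φ j : ℤ) : K) -
    (1 : Matrix (Fin n) (Fin n) K) i j = a * w i * φ j
  by_cases hij : i = j <;> simp [Matrix.one_apply, hij]

variable {K : Type*} [Field K]

lemma ker_mulVecLin_vecMulVec {w : Fin n → K} (hw : w ≠ 0) (φ : Fin n → K) :
    LinearMap.ker (mulVecLin (vecMulVec w φ)) = LinearMap.ker (dotProductBilin K K φ) := by
  ext x
  simp [vecMulVec_mulVec, hw]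

lemma range_mulVecLin_vecMulVec (w : Fin n → K) {φ : Fin n → K} (hφ : φ ≠ 0) :
    LinearMap.range (mulVecLin (vecMulVec w φ)) = Submodule.span K {w} := by
  obtain ⟨i, hi⟩ := Function.ne_iff.mp hφ
  ext x
  simp only [LinearMap.mem_range, mulVecLin_apply, Submodule.mem_span_singleton, vecMulVec_mulVec]
  constructor
  · rintro ⟨y, rfl⟩
    exact ⟨φ ⬝ᵥ y, by ext; simp [mul_comm]⟩
  · rintro ⟨c, rfl⟩
    refine ⟨Pi.single i (c / φ i), ?_⟩
    have : φ i ≠ 0 := hi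
    ext j
    simp
    field_simp

lemma isNilpotent_mulVecLin_vecMulVec {w φ : Fin n → K} (h : φ ⬝ᵥ w = 0) :
    IsNilpotent (mulVecLin (vecMulVec w φ)) := by
  refine ⟨2, ?_⟩
  rw [pow_two, Module.End.mul_eq_comp, ← mulVecLin_mul, vecMulVec_mul_vecMulVec]
  simp [h]

end Transvection

section Rational

variable {n : ℕ}

lemma exists_integral_multiple (v : Fin n → ℚ) :
    ∃ (N : ℤ) (w : Fin n → ℤ), N ≠ 0 ∧ ∀ i, (w i : ℚ) = N * v i := by
  obtain ⟨b, hb⟩ := IsLocalization.exist_integer_multiples_of_finite (nonZeroDivisors ℤ) v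
  choose w hw using hb
  refine ⟨b, w, nonZeroDivisors.coe_ne_zero b, fun i => ?_⟩
  simpa [zsmul_eq_mul] using hw i

lemma RatPoint.exists_int {p : Proj n} (hp : RatPoint p) :
    ∃ w : Fin n → ℤ, w ≠ 0 ∧ p.submodule = Submodule.span ℝ {fun i => (w i : ℝ)} := by
  obtain ⟨v, hv⟩ := hp
  obtain ⟨N, w, hN, hw⟩ := exists_integral_multiple v
  have hN' : (N : ℝ) ≠ 0 := by exact_mod_cast hN
  have hw' : (fun i => (w i : ℝ)) = (N : ℝ) • fun i => (v i : ℝ) := by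
    ext i
    have := hw i
    simp only [Pi.smul_apply, smul_eq_mul]
    exact_mod_cast this
  have hspan : p.submodule = Submodule.span ℝ {fun i => (w i : ℝ)} := by
    rw [hv, hw', Submodule.span_singleton_smul_eq (isUnit_iff_ne_zero.mpr hN')]
  refine ⟨w, ?_, hspan⟩
  rintro rfl
  have h1 := p.finrank_submodule
  have h0 : (fun i : Fin n => (((0 : Fin n → ℤ) i : ℤ) : ℝ)) = 0 := by ext; simp
  rw [hspan, h0, Submodule.span_zero_singleton, finrank_bot] at h1
  exact zero_ne_one h1

lemma dotProductBilin_ne_zero {K : Type*} [Field K] {φ : Fin n → K} (hφ : φ ≠ 0) :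
    dotProductBilin K K φ ≠ 0 := by
  intro h
  refine hφ (dotProduct_eq_zero φ fun x => ?_)
  simpa using LinearMap.congr_fun h x

lemma IsRatSubmodule.exists_int {W : Submodule ℝ (Fin n → ℝ)} (hW : IsRatSubmodule W)
    (hn : 1 ≤ n) (hWrank : Module.finrank ℝ W = n - 1) :
    ∃ φ : Fin n → ℤ, φ ≠ 0 ∧ LinearMap.ker (dotProductBilin ℝ ℝ fun i => (φ i : ℝ)) = W := by
  obtain ⟨T, hT⟩ := hW
  let c : (Fin n → ℚ) →ₗ[ℚ] (Fin n → ℝ) := (Algebra.linearMap ℚ ℝ).compLeft (Fin n)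
  have hc : ∀ v : Fin n → ℚ, c v = fun i => (v i : ℝ) := fun v => by ext i; simp [c]
  have hlt : Submodule.span ℚ T < ⊤ := by
    rw [lt_top_iff_ne_top]
    intro htop
    have hle : Submodule.span ℚ T ≤ (W.restrictScalars ℚ).comap c := by
      rw [Submodule.span_le]
      intro t ht
      change c t ∈ W
      rw [hT, hc]
      exact Submodule.subset_span ⟨t, ht, rfl⟩
    have hWtop : W = ⊤ := by
      rw [eq_top_iff, ← (Pi.basisFun ℝ (Fin n)).span_eq, Submodule.span_le]
      rintro _ ⟨i, rfl⟩
      have : c (Pi.single i 1) ∈ W := hle (htop ▸ Submodule.mem_top)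
      rw [hc] at this
      change Pi.basisFun ℝ (Fin n) i ∈ W
      convert this using 1
      ext j
      by_cases hj : j = i <;> simp [hj]
    rw [hWtop, finrank_top, Module.finrank_fin_fun] at hWrank
    omega
  obtain ⟨f, hf0, hf⟩ := Submodule.exists_le_ker_of_lt_top _ hlt
  obtain ⟨N, φ, hN, hφ⟩ := exists_integral_multiple fun i => f (Pi.single i 1)
  have hfφ : ∀ v : Fin n → ℚ, (fun i => (φ i : ℚ)) ⬝ᵥ v = N * f v := by
    intro v
    conv_rhs => rw [pi_eq_sum_univ' v, map_sum, Finset.mul_sum]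
    refine Finset.sum_congr rfl fun i _ => ?_
    simp only [map_smul, smul_eq_mul, hφ i]
    ring
  have hφ0 : φ ≠ 0 := by
    rintro rfl
    refine hf0 (LinearMap.ext fun v => ?_)
    have := hfφ v
    have hN' : (N : ℚ) ≠ 0 := by exact_mod_cast hN
    simpa [dotProduct, hN'] using this
  refine ⟨φ, hφ0, ?_⟩
  have hφR : (fun i => (φ i : ℝ)) ≠ 0 := by
    intro h
    exact hφ0 (funext fun i => by simpa using congrFun h i)
  symm
  refine Submodule.eq_of_le_of_finrank_eq ?_ ?_
  · rw [hT, Submodule.span_le]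
    rintro _ ⟨t, ht, rfl⟩
    have h0 : f t = 0 := hf (Submodule.subset_span ht)
    have := hfφ t
    rw [h0, mul_zero] at this
    simp only [SetLike.mem_coe, LinearMap.mem_ker, dotProductBilin_apply_apply]
    simp only [dotProduct] at this ⊢
    exact_mod_cast this
  · have h1 := Module.Dual.finrank_ker_add_one_of_ne_zero (dotProductBilin_ne_zero hφR)
    rw [Module.finrank_fin_fun] at h1
    omega

end Rational

section Dynamics

variable {n : ℕ}

lemma act_transv_mk (w φ : Fin n → ℤ) (h : φ ⬝ᵥ w = 0) {a : ℤ} (ha : a ≠ 0)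
    (y : Fin n → ℝ) (hy : y ≠ 0) {U : Set (Proj n)}
    (hU : ∃ h0 : (a : ℝ)⁻¹ • y + ((fun i => (φ i : ℝ)) ⬝ᵥ y) • (fun i => (w i : ℝ)) ≠ 0,
      Projectivization.mk ℝ _ h0 ∈ U) :
    act (transv w φ h a) (Projectivization.mk ℝ y hy) ∈ U := by
  obtain ⟨h0, hmem⟩ := hU
  convert hmem using 1
  rw [act, actR, Projectivization.map_mk, Projectivization.mk_eq_mk_iff']
  refine ⟨(a : ℝ), ?_⟩
  have ha' : (a : ℝ) ≠ 0 := by exact_mod_cast ha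
  have key := congrArg (fun M => M *ᵥ y) (map_transv_sub_one (K := ℝ) w φ h a)
  simp only [sub_mulVec, one_mulVec, vecMulVec_mulVec, sub_eq_iff_eq_add] at key
  change _ = _ *ᵥ y
  rw [key, smul_add, smul_inv_smul₀ ha', add_comm]
  congr 1
  ext i
  simp
  ring

/-- Outside a neighbourhood of the hyperplane `φ = 0`, all nontrivial powers of a sufficiently
large transvection map into a prescribed neighbourhood of its attracting point. -/
lemma exists_transv_attracting (w φ : Fin n → ℤ) (h : φ ⬝ᵥ w = 0)
    (hw : (fun i => (w i : ℝ)) ≠ 0) {U V : Set (Proj n)} (hU : IsOpen U) (hV : IsOpen V)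
    (hpU : Projectivization.mk ℝ _ hw ∈ U)
    (hLV : ∀ (y : Fin n → ℝ) (hy : y ≠ 0), (fun i => (φ i : ℝ)) ⬝ᵥ y = 0 →
      Projectivization.mk ℝ y hy ∈ V) :
    ∃ N : ℤ, N ≠ 0 ∧ ∀ k : ℤ, k ≠ 0 → ∀ x ∉ V, act (transv w φ h N ^ k) x ∈ U := by
  set wR : Fin n → ℝ := fun i => (w i : ℝ)
  set φR : Fin n → ℝ := fun i => (φ i : ℝ)
  have hK : IsCompact (Metric.sphere (0 : Fin n → ℝ) 1 \
      {y | ∃ h : y ≠ 0, Projectivization.mk ℝ y h ∈ V}) :=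
    (isCompact_sphere _ _).diff (isOpen_cone hV)
  have hF : Continuous fun q : ℝ × (Fin n → ℝ) => q.1 • q.2 + (φR ⬝ᵥ q.2) • wR := by
    simp only [dotProduct]
    fun_prop
  have hev := hK.eventually_forall_of_forall_eventually (x₀ := (0 : ℝ))
    (P := fun t y => ∃ h : t • y + (φR ⬝ᵥ y) • wR ≠ 0, Projectivization.mk ℝ _ h ∈ U) <| by
      rintro y ⟨hy1, hyV⟩
      have hy0 : y ≠ 0 := by
        rintro rfl
        simp at hy1
      have hφy : φR ⬝ᵥ y ≠ 0 := fun h0 => hyV ⟨hy0, hLV y hy0 h0⟩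
      have := hF.continuousAt.preimage_mem_nhds
        (x := ((0 : ℝ), y)) ((isOpen_cone hU).mem_nhds ?_)
      · exact this
      · have hz : (φR ⬝ᵥ y) • wR ≠ 0 := smul_ne_zero hφy hw
        refine ⟨by simpa only [zero_smul, zero_add] using hz, ?_⟩
        convert hpU using 1
        rw [Projectivization.mk_eq_mk_iff']
        exact ⟨φR ⬝ᵥ y, by simp only [zero_smul, zero_add, wR]⟩
  obtain ⟨T, hT, hTK⟩ := Metric.eventually_nhds_iff.mp hev
  obtain ⟨N, hN⟩ := exists_nat_one_div_lt hT
  refine ⟨(N : ℤ) + 1, by positivity, fun k hk x hx => ?_⟩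
  induction x using Projectivization.ind with
  | h y hy =>
  have hny : ‖y‖⁻¹ ≠ 0 := by simpa using hy
  have hy' : ‖y‖⁻¹ • y ≠ 0 := smul_ne_zero hny hy
  have hmk : Projectivization.mk ℝ y hy = Projectivization.mk ℝ (‖y‖⁻¹ • y) hy' := by
    rw [eq_comm, Projectivization.mk_eq_mk_iff']
    exact ⟨‖y‖⁻¹, rfl⟩
  rw [hmk] at hx ⊢
  rw [transv_zpow]
  refine act_transv_mk w φ h (mul_ne_zero (by positivity) hk) _ _ (hTK ?_ _ ⟨?_, ?_⟩)
  · have hk1 : (1 : ℝ) ≤ |(k : ℝ)| := by exact_mod_cast Int.one_le_abs hk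
    have hN0 : (0 : ℝ) < N + 1 := by positivity
    rw [dist_zero_right, Real.norm_eq_abs, abs_inv]
    push_cast
    rw [abs_mul, abs_of_pos hN0]
    refine lt_of_le_of_lt ?_ hN
    rw [one_div]
    exact inv_anti₀ hN0 (le_mul_of_one_le_right hN0.le hk1)
  · rw [mem_sphere_zero_iff_norm, norm_smul, norm_inv, norm_norm,
      inv_mul_cancel₀ (norm_ne_zero_iff.mpr hy)]
  · rintro ⟨_, hmem⟩
    exact hx hmem

end Dynamics

/-- Lemma 2.5 (adding a generator to a Schottky system): given a Schottky system
`(S, 𝒜, ℛ)`, a rational point `p` on a rational hyperplane `L`, and `δ ≥ ε > 0`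
with `[p]_ε ∩ ℛ = ∅` and `[L]_δ ∩ 𝒜 = ∅`, there is a rank-1 unipotent `v` with
`p_v = p`, `L_v = L` such that `(S ∪ {v}, 𝒜 ∪ [p]_ε, ℛ ∪ [L]_δ)` is a Schottky
system containing `(S, 𝒜, ℛ)`. -/
theorem schottky_adding (n : ℕ) (hn : 3 ≤ n) (d : Proj n → Proj n → ℝ)
    (hd : IsCompatMetric d) (S : Set (SLZ n)) (A R : Set (Proj n))
    (hS : IsSchottky d S A R) (ε δ : ℝ) (hε : 0 < ε) (hεδ : ε ≤ δ)
    (p : Proj n) (hp : RatPoint p)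
    (W : Submodule ℝ (Fin n → ℝ)) (hW : IsRatSubmodule W)
    (hWrank : Module.finrank ℝ W = n - 1) (hpW : p.submodule ≤ W)
    (hpR : cThick d {p} ε ∩ R = ∅) (hWA : cThick d (projSet W) δ ∩ A = ∅) :
    ∃ v : SLZ n, IsR1U v ∧ lineOf v = p.submodule ∧ hypOf v = W ∧
      IsSchottky d (S ∪ {v}) (A ∪ cThick d {p} ε) (R ∪ cThick d (projSet W) δ) := by
  obtain ⟨w, hw0, hw⟩ := hp.exists_int
  obtain ⟨φ, hφ0, hφ⟩ := hW.exists_int (by omega) hWrank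
  have cast_ne : ∀ {K : Type} [Field K] [CharZero K] {z : Fin n → ℤ}, z ≠ 0 →
      (fun i => (z i : K)) ≠ 0 := fun hz h => hz (funext fun i => by simpa using congrFun h i)
  have hwR := cast_ne (K := ℝ) hw0
  have hφw : φ ⬝ᵥ w = 0 := by
    have : (fun i => (w i : ℝ)) ∈ LinearMap.ker (dotProductBilin ℝ ℝ fun i => (φ i : ℝ)) := by
      rw [hφ]
      exact hpW (hw ▸ Submodule.mem_span_singleton_self _)
    simp only [LinearMap.mem_ker, dotProductBilin_apply_apply, dotProduct] at this
    simp only [dotProduct]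
    exact_mod_cast this
  have hpmk : Projectivization.mk ℝ _ hwR = p := by
    apply Projectivization.submodule_injective
    rw [Projectivization.submodule_mk, hw]
  have hpL : p ∈ projSet W := hpW
  have hLne : (projSet W).Nonempty := ⟨p, hpL⟩
  have hpne : ({p} : Set (Proj n)).Nonempty := ⟨p, rfl⟩
  have hδ : 0 < δ := hε.trans_le hεδ
  obtain ⟨N, hN, hatt⟩ := exists_transv_attracting w φ hφw hwR
    (hd.isOpen_oThick hpne ε) (hd.isOpen_oThick hLne δ)
    (by rw [hpmk]; exact hd.subset_oThick _ hε rfl)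
    (fun y hy h0 => hd.subset_oThick _ hδ (by
      change Projectivization.submodule _ ≤ W
      rw [Projectivization.submodule_mk, Submodule.span_singleton_le_iff_mem, ← hφ]
      simpa using h0))
  set v := transv w φ hφw N with hv
  have hNR : (N : ℝ) ≠ 0 := by exact_mod_cast hN
  have hNQ : (N : ℚ) ≠ 0 := by exact_mod_cast hN
  have hR1U : IsR1U v := by
    rw [IsR1U, linQ, matQ, hv, map_transv_sub_one]
    constructor
    · apply isNilpotent_mulVecLin_vecMulVec
      rw [dotProduct_smul, smul_eq_zero]
      right
      simp only [dotProduct] at hφw ⊢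
      exact_mod_cast hφw
    · rw [range_mulVecLin_vecMulVec _ (cast_ne hφ0)]
      exact finrank_span_singleton (smul_ne_zero hNQ (cast_ne hw0))
  have hline : lineOf v = p.submodule := by
    rw [lineOf, matR, hv, map_transv_sub_one, range_mulVecLin_vecMulVec _ (cast_ne hφ0), hw,
      Submodule.span_singleton_smul_eq (isUnit_iff_ne_zero.mpr hNR)]
  have hhyp : hypOf v = W := by
    rw [hypOf, matR, hv, map_transv_sub_one, ker_mulVecLin_vecMulVec (smul_ne_zero hNR hwR), hφ]
  have hattS : attSet v = {p} := by
    ext x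
    rw [attSet, Set.mem_ofPred_eq, hline, Set.mem_singleton_iff]
    exact Projectivization.submodule_injective.eq_iff
  have hfixS : fixSet v = projSet W := by rw [fixSet, hhyp, projSet]
  refine ⟨v, hR1U, hline, hhyp, ?_⟩
  obtain ⟨ε', δ', hpos, hping, hdisj, hA, hR⟩ := hS.cond
  have hvS : v ∉ S := fun hvS => by
    have hpA := hA v hvS (hd.subset_oThick _ (hpos v hvS).1 (hattS ▸ rfl : p ∈ attSet v))
    have : p ∈ cThick d {p} ε ∩ R :=
      ⟨oThick_subset_cThick _ _ (hd.subset_oThick _ hε rfl), hS.AsubR hpA⟩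
    rw [hpR] at this
    exact this
  have hne : ∀ u ∈ S, u ≠ v := fun u hu h => hvS (h ▸ hu)
  classical
  refine ⟨hS.nonempty.inl, ?_, ?_, hS.closedA.union (hd.isClosed_cThick hpne ε),
    hS.closedR.union (hd.isClosed_cThick hLne δ),
    Function.update ε' v ε, Function.update δ' v δ, ?_, ?_, ?_, ?_, ?_⟩
  · rintro u (hu | rfl)
    exacts [hS.unip u hu, hR1U]
  · refine Set.union_subset_union hS.AsubR fun x hx => ?_
    have hx' : setDist d x {p} ≤ ε := hx
    rw [setDist_singleton] at hx'
    exact (hd.setDist_le hpL x).trans (hx'.trans hεδ)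
  · rintro u (hu | rfl)
    · simpa [hne u hu] using hpos u hu
    · simpa using ⟨hε, hεδ⟩
  · rintro u (hu | rfl)
    · simpa [hne u hu] using hping u hu
    · simpa [hattS, hfixS] using hatt
  · rintro u (hu | rfl) u' (hu' | rfl) huu'
    · simpa [hne u hu, hne u' hu'] using hdisj u hu u' hu' huu'
    · rw [Function.update_of_ne huu', Function.update_self, hfixS, ← Set.subset_empty_iff, ← hWA]
      exact fun x hx => ⟨oThick_subset_cThick _ _ hx.2, hA u hu hx.1⟩
    · rw [Function.update_of_ne huu'.symm, Function.update_self, hattS, ← Set.subset_empty_iff,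
        ← hpR]
      exact fun x hx => ⟨oThick_subset_cThick _ _ hx.1, hR u' hu' hx.2⟩
    · exact absurd rfl huu'
  · rintro u (hu | rfl)
    · rw [Function.update_of_ne (hne u hu)]
      exact (hA u hu).trans Set.subset_union_left
    · rw [Function.update_self, hattS]
      exact (oThick_subset_cThick _ _).trans Set.subset_union_right
  · rintro u (hu | rfl)
    · rw [Function.update_of_ne (hne u hu)]
      exact (hR u hu).trans Set.subset_union_left
    · rw [Function.update_self, hfixS]
      exact (oThick_subset_cThick _ _).trans Set.subset_union_right
end

section
/- Let n ≥ 3 and let Γ be a Zariski-dense subgroup of SL(n,ℤ). Assume u ∈ Γ is a rank-1 unipotent element, v ∈ Γ is unipotent, and ⟨u,v⟩ ≅ ℤ². Then Γ has finite index in SL(n,ℤ). In particular, if Γ is moreover profinitely dense then Γ = SL(n,ℤ). -/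
/- Common setup: `SL(n,ℤ)`, `SL(n,ℝ)`, the real projective space `ℙ^{n-1}(ℝ)`
with its quotient topology and the projective action, rank-1 unipotent elements
and their attracting points / fixed hyperplanes, metrics compatible with the
topology of `ℙ`, `ε`-neighbourhoods, Schottky systems, profinite density,
maximal subgroups, and lattices in `SL(n,ℝ)`. -/

open Matrix LinearAlgebra.Projectivization

/-- `Γ ≤ SL(n,ℤ)` is Zariski dense: every polynomial with rational coefficients in
the matrix entries vanishing on `Γ` vanishes on all complex matrices of determinant 1. -/
def ZariskiDense {n : ℕ} (Γ : Subgroup (SLZ n)) : Prop :=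
  ∀ f : MvPolynomial (Fin n × Fin n) ℚ,
    (∀ g ∈ Γ, MvPolynomial.aeval
        (fun q : Fin n × Fin n => (((g : Matrix (Fin n) (Fin n) ℤ) q.1 q.2 : ℤ) : ℂ)) f = 0) →
    ∀ M : Matrix (Fin n) (Fin n) ℂ, M.det = 1 →
      MvPolynomial.aeval (fun q : Fin n × Fin n => M q.1 q.2) f = 0

namespace Venkataramana

section OneAdd

variable {ι R : Type*} [Fintype ι] [DecidableEq ι] [CommRing R]

/-- `Γ` contains an element whose matrix is `1 + X`. -/
def HasOneAdd (Γ : Subgroup (SpecialLinearGroup ι R)) (X : Matrix ι ι R) : Prop :=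
  ∃ g ∈ Γ, (g : Matrix ι ι R) = 1 + X

/-- `Γ` contains the transvection `1 + x ψ`. -/
def HasTransvection (Γ : Subgroup (SpecialLinearGroup ι R)) (x ψ : ι → R) : Prop :=
  HasOneAdd Γ (vecMulVec x ψ)

variable {Γ Δ : Subgroup (SpecialLinearGroup ι R)} {X Y : Matrix ι ι R}

lemma HasOneAdd.mono (h : HasOneAdd Γ X) (hle : Γ ≤ Δ) : HasOneAdd Δ X :=
  let ⟨g, hg, e⟩ := h
  ⟨g, hle hg, e⟩

lemma HasOneAdd.zero : HasOneAdd Γ 0 := ⟨1, one_mem _, by simp⟩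

lemma HasOneAdd.add (hX : HasOneAdd Γ X) (hY : HasOneAdd Γ Y) (h : X * Y = 0) :
    HasOneAdd Γ (X + Y) := by
  obtain ⟨g, hg, eg⟩ := hX
  obtain ⟨k, hk, ek⟩ := hY
  refine ⟨g * k, mul_mem hg hk, ?_⟩
  rw [Matrix.SpecialLinearGroup.coe_mul, eg, ek, mul_add, add_mul, add_mul, h]
  simp [add_assoc]

lemma coe_inv_of_eq {g : SpecialLinearGroup ι R} (hg : (g : Matrix ι ι R) = 1 + X)
    (h : X * X = 0) : ((g⁻¹ : SpecialLinearGroup ι R) : Matrix ι ι R) = 1 - X := by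
  have h1 : (g : Matrix ι ι R) * (1 - X) = 1 := by
    rw [hg, mul_sub, mul_one, add_mul, one_mul, h]; simp
  calc ((g⁻¹ : SpecialLinearGroup ι R) : Matrix ι ι R)
      = (g⁻¹ : SpecialLinearGroup ι R) * ((g : Matrix ι ι R) * (1 - X)) := by rw [h1, mul_one]
    _ = 1 - X := by
      rw [← mul_assoc, ← Matrix.SpecialLinearGroup.coe_mul, inv_mul_cancel,
        Matrix.SpecialLinearGroup.coe_one, one_mul]

lemma HasOneAdd.neg (hX : HasOneAdd Γ X) (h : X * X = 0) : HasOneAdd Γ (-X) := by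
  obtain ⟨g, hg, eg⟩ := hX
  exact ⟨g⁻¹, inv_mem hg, by rw [coe_inv_of_eq eg h, sub_eq_add_neg]⟩

lemma HasOneAdd.nsmul (hX : HasOneAdd Γ X) (h : X * X = 0) (k : ℕ) : HasOneAdd Γ (k • X) := by
  induction k with
  | zero => simpa using HasOneAdd.zero
  | succ k ih =>
    rw [succ_nsmul]
    exact ih.add hX (by rw [smul_mul_assoc, h, smul_zero])

lemma HasOneAdd.zsmul (hX : HasOneAdd Γ X) (h : X * X = 0) (k : ℤ) : HasOneAdd Γ (k • X) := by
  obtain ⟨m, rfl | rfl⟩ := k.eq_nat_or_neg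
  · simpa using hX.nsmul h m
  · rw [neg_smul]
    refine HasOneAdd.neg (by simpa using hX.nsmul h m) ?_
    rw [smul_mul_assoc, mul_smul_comm, h, smul_zero, smul_zero]

lemma det_one_add_vecMulVec (x ψ : ι → R) : (1 + vecMulVec x ψ).det = 1 + ψ ⬝ᵥ x := by
  rw [vecMulVec_eq Unit, det_one_add_mul_comm]
  simp [Matrix.mul_apply, dotProduct]

lemma HasTransvection.dotProduct_eq {x ψ : ι → R} (h : HasTransvection Γ x ψ) : ψ ⬝ᵥ x = 0 := by
  obtain ⟨g, -, e⟩ := h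
  have := g.det_coe
  rw [e, det_one_add_vecMulVec] at this
  simpa using this

omit [DecidableEq ι] in
lemma vecMulVec_mul_self {x ψ : ι → R} (h : ψ ⬝ᵥ x = 0) :
    vecMulVec x ψ * vecMulVec x ψ = 0 := by
  rw [vecMulVec_mul_vecMulVec, h]; simp

lemma hasTransvection_top {x ψ : ι → R} (h : ψ ⬝ᵥ x = 0) :
    HasTransvection (⊤ : Subgroup (SpecialLinearGroup ι R)) x ψ :=
  ⟨⟨1 + vecMulVec x ψ, by rw [det_one_add_vecMulVec, h, add_zero]⟩, trivial, rfl⟩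

lemma HasTransvection.add_right {x ψ χ : ι → R} (h : HasTransvection Γ x ψ)
    (h' : HasTransvection Γ x χ) : HasTransvection Γ x (ψ + χ) := by
  rw [HasTransvection, vecMulVec_add]
  refine HasOneAdd.add h h' ?_
  rw [vecMulVec_mul_vecMulVec, h.dotProduct_eq]; simp

lemma HasTransvection.add_left {x y ψ : ι → R} (h : HasTransvection Γ x ψ)
    (h' : HasTransvection Γ y ψ) : HasTransvection Γ (x + y) ψ := by
  rw [HasTransvection, add_vecMulVec]
  refine HasOneAdd.add h h' ?_
  rw [vecMulVec_mul_vecMulVec, h'.dotProduct_eq]; simp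

lemma HasTransvection.neg_right {x ψ : ι → R} (h : HasTransvection Γ x ψ) :
    HasTransvection Γ x (-ψ) := by
  rw [HasTransvection, vecMulVec_neg]
  exact HasOneAdd.neg h (vecMulVec_mul_self h.dotProduct_eq)

lemma HasTransvection.neg_left {x ψ : ι → R} (h : HasTransvection Γ x ψ) :
    HasTransvection Γ (-x) ψ := by
  rw [HasTransvection, neg_vecMulVec]
  exact HasOneAdd.neg h (vecMulVec_mul_self h.dotProduct_eq)

/-- The covectors `ψ` such that `1 + x ψ` lies in `Γ`. -/
def covectors (Γ : Subgroup (SpecialLinearGroup ι R)) (x : ι → R) : AddSubgroup (ι → R) where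
  carrier := {ψ | HasTransvection Γ x ψ}
  zero_mem' := by
    change HasOneAdd Γ _
    rw [vecMulVec_zero]
    exact HasOneAdd.zero
  add_mem' := HasTransvection.add_right
  neg_mem' := HasTransvection.neg_right

/-- The vectors `x` such that `1 + x ψ` lies in `Γ`. -/
def vectors (Γ : Subgroup (SpecialLinearGroup ι R)) (ψ : ι → R) : AddSubgroup (ι → R) where
  carrier := {x | HasTransvection Γ x ψ}
  zero_mem' := by
    change HasOneAdd Γ _
    rw [zero_vecMulVec]
    exact HasOneAdd.zero
  add_mem' := HasTransvection.add_left
  neg_mem' := HasTransvection.neg_left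

lemma mem_covectors {x ψ : ι → R} : ψ ∈ covectors Γ x ↔ HasTransvection Γ x ψ := Iff.rfl

lemma mem_vectors {x ψ : ι → R} : x ∈ vectors Γ ψ ↔ HasTransvection Γ x ψ := Iff.rfl

lemma HasTransvection.conj {x ψ : ι → R} (h : HasTransvection Γ x ψ)
    {γ : SpecialLinearGroup ι R} (hγ : γ ∈ Γ) :
    HasTransvection Γ ((γ : Matrix ι ι R) *ᵥ x)
      (ψ ᵥ* ((γ⁻¹ : SpecialLinearGroup ι R) : Matrix ι ι R)) := by
  obtain ⟨g, hg, e⟩ := h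
  refine ⟨γ * g * γ⁻¹, mul_mem (mul_mem hγ hg) (inv_mem hγ), ?_⟩
  rw [Matrix.SpecialLinearGroup.coe_mul, Matrix.SpecialLinearGroup.coe_mul, e, mul_add, add_mul,
    mul_one, mul_vecMulVec, vecMulVec_mul, ← Matrix.SpecialLinearGroup.coe_mul, mul_inv_cancel,
    Matrix.SpecialLinearGroup.coe_one]

lemma HasTransvection.commutator {x ψ y χ : ι → R} (h : HasTransvection Γ x ψ)
    (h' : HasTransvection Δ y χ) (h0 : χ ⬝ᵥ x = 0) :
    HasTransvection ⁅Γ, Δ⁆ x ((ψ ⬝ᵥ y) • χ) := by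
  have hX := vecMulVec_mul_self h.dotProduct_eq
  have hY := vecMulVec_mul_self h'.dotProduct_eq
  have hYX : vecMulVec y χ * vecMulVec x ψ = 0 := by
    rw [vecMulVec_mul_vecMulVec, h0]; simp
  have hXY : vecMulVec x ((ψ ⬝ᵥ y) • χ) = vecMulVec x ψ * vecMulVec y χ := by
    rw [vecMulVec_mul_vecMulVec]
  rw [HasTransvection, hXY]
  obtain ⟨g, hg, eg⟩ := h
  obtain ⟨k, hk, ek⟩ := h'
  refine ⟨g * k * g⁻¹ * k⁻¹, Subgroup.commutator_mem_commutator hg hk, ?_⟩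
  simp only [Matrix.SpecialLinearGroup.coe_mul]
  rw [coe_inv_of_eq eg hX, coe_inv_of_eq ek hY, eg, ek]
  set X := vecMulVec x ψ
  set Y := vecMulVec y χ
  have e1 : (1 + X) * (1 + Y) * (1 - X) * (1 - Y) = 1 + X * Y - X * X - Y * Y - Y * X + X * X * Y
      + Y * X * Y - X * (Y * X) - X * (Y * Y) + X * (Y * X) * Y := by noncomm_ring
  rw [e1, hX, hY, hYX]
  simp

lemma HasTransvection.comm {x ψ y χ : ι → R} (h : HasTransvection Γ x ψ)
    (h' : HasTransvection Γ y χ) (h0 : χ ⬝ᵥ x = 0) :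
    HasTransvection Γ x ((ψ ⬝ᵥ y) • χ) :=
  HasOneAdd.mono (h.commutator h' h0) <| Subgroup.commutator_le.2 fun _ h₁ _ h₂ =>
    mul_mem (mul_mem (mul_mem h₁ h₂) (inv_mem h₁)) (inv_mem h₂)

lemma HasTransvection.exists_mulVec {x ψ : ι → R} (h : HasTransvection Γ x ψ) (c : ι → R) :
    ∃ g ∈ Γ, (g : Matrix ι ι R) *ᵥ c = c + (ψ ⬝ᵥ c) • x := by
  obtain ⟨g, hg, e⟩ := h
  refine ⟨g, hg, ?_⟩
  rw [e, add_mulVec, one_mulVec, vecMulVec_mulVec]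
  ext; simp [mul_comm]

end OneAdd

section Generation

variable {ι R : Type*} [Fintype ι] [DecidableEq ι]

lemma HasTransvection.exists_mul_apply [CommRing R] {H : Subgroup (SpecialLinearGroup ι R)}
    {x : ι → R} {j : ι} {t : R} (h : HasTransvection H x (Pi.single j t))
    (g : SpecialLinearGroup ι R) :
    ∃ k ∈ H, ∀ a b, (k * g) a b = g a b + x a * (t * g j b) := by
  obtain ⟨k, hk, e⟩ := h
  refine ⟨k, hk, fun a b => ?_⟩
  rw [Matrix.SpecialLinearGroup.coe_mul, e, add_mul, one_mul, vecMulVec_mul, Matrix.add_apply,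
    vecMulVec_apply, single_vecMul]
  simp

/-- The subgroup `H` contains all elementary transvections. -/
def HasElementary [CommRing R] (H : Subgroup (SpecialLinearGroup ι R)) : Prop :=
  ∀ i j : ι, i ≠ j → ∀ t : R, HasTransvection H (Pi.single i 1) (Pi.single j t)

variable [EuclideanDomain R] {H : Subgroup (SpecialLinearGroup ι R)}

lemma HasElementary.exists_dvd (hH : HasElementary H) (S : Finset ι) (k : ι) (m : R) :
    ∀ g : SpecialLinearGroup ι R, (∀ l ∉ S, ∀ a, g a l = (1 : Matrix ι ι R) a l) →
    ∀ j ∈ S, g j k = m → m ≠ 0 → ∃ h ∈ H,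
      (∀ l ∉ S, ∀ a, (h * g) a l = (1 : Matrix ι ι R) a l) ∧
      ∃ j ∈ S, ∀ i ∈ S, (h * g) j k ∣ (h * g) i k := by
  induction m using (EuclideanDomain.r_wellFounded (R := R)).induction with
  | _ m ih =>
    intro g hg j hj hm h0
    by_cases hd : ∀ i ∈ S, g j k ∣ g i k
    · exact ⟨1, one_mem _, by simpa using hg, j, hj, by simpa using hd⟩
    push Not at hd
    obtain ⟨i, hi, hndvd⟩ := hd
    have hij : i ≠ j := by rintro rfl; exact hndvd dvd_rfl
    obtain ⟨h, hh, e⟩ := (hH i j hij (-(g i k / m))).exists_mul_apply g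
    have hS : ∀ l ∉ S, ∀ a, (h * g) a l = (1 : Matrix ι ι R) a l := by
      intro l hl a
      rw [e, hg l hl, hg l hl, Matrix.one_apply_ne (i := j) (by rintro rfl; exact hl hj)]
      simp
    have hik : (h * g) i k = g i k % m := by
      rw [e, hm, EuclideanDomain.mod_eq_sub_mul_div]; simp; ring
    obtain ⟨h', hh', p1, p2⟩ := ih (g i k % m) (EuclideanDomain.mod_lt _ h0) (h * g) hS i hi hik
      (by rw [Ne, EuclideanDomain.mod_eq_zero, ← hm]; exact hndvd)
    exact ⟨h' * h, mul_mem hh' hh, by simpa only [mul_assoc] using p1,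
      by simpa only [mul_assoc] using p2⟩

lemma HasElementary.exists_isUnit (hH : HasElementary H) (S : Finset ι) {k : ι} (hk : k ∈ S)
    (g : SpecialLinearGroup ι R) (hg : ∀ l ∉ S, ∀ a, g a l = (1 : Matrix ι ι R) a l) :
    ∃ h ∈ H, (∀ l ∉ S, ∀ a, (h * g) a l = (1 : Matrix ι ι R) a l) ∧
      ∃ j ∈ S, IsUnit ((h * g) j k) := by
  have key : ∀ g : SpecialLinearGroup ι R, (∀ l ∉ S, ∀ a, g a l = (1 : Matrix ι ι R) a l) →
      ∑ i ∈ S, (g⁻¹ : SpecialLinearGroup ι R) k i * g i k = 1 := by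
    intro g hg
    have h1 : ∀ l ∉ S, (g⁻¹ : SpecialLinearGroup ι R) k l = 0 := by
      intro l hl
      have : ((g⁻¹ * g : SpecialLinearGroup ι R) : Matrix ι ι R) k l = 0 := by
        rw [inv_mul_cancel, Matrix.SpecialLinearGroup.coe_one,
          Matrix.one_apply_ne (by rintro rfl; exact hl hk)]
      rw [Matrix.SpecialLinearGroup.coe_mul, Matrix.mul_apply] at this
      simpa [hg l hl, Matrix.one_apply] using this
    have h2 : ((g⁻¹ * g : SpecialLinearGroup ι R) : Matrix ι ι R) k k = 1 := by
      rw [inv_mul_cancel, Matrix.SpecialLinearGroup.coe_one, Matrix.one_apply_eq]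
    rw [Matrix.SpecialLinearGroup.coe_mul, Matrix.mul_apply] at h2
    refine Eq.trans ?_ h2
    exact Finset.sum_subset (Finset.subset_univ _) fun l _ hl => by rw [h1 l hl, zero_mul]
  obtain ⟨j, hj, hj0⟩ : ∃ j ∈ S, g j k ≠ 0 := by
    by_contra! hc
    have := key g hg
    rw [Finset.sum_eq_zero fun i hi => by rw [hc i hi, mul_zero]] at this
    exact zero_ne_one this
  obtain ⟨h, hh, hS, j, hj, hd⟩ := hH.exists_dvd S k _ g hg j hj rfl hj0
  refine ⟨h, hh, hS, j, hj, isUnit_of_dvd_one ?_⟩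
  have := Finset.dvd_sum fun i hi => (hd i hi).mul_left ((h * g)⁻¹ k i)
  rwa [key _ hS] at this

lemma HasElementary.exists_eq_one (hH : HasElementary H) (S : Finset ι) {k : ι} (hk : k ∈ S)
    (g : SpecialLinearGroup ι R) (hg : ∀ l ∉ S, ∀ a, g a l = (1 : Matrix ι ι R) a l) :
    ∃ h ∈ H, (∀ l ∉ S, ∀ a, (h * g) a l = (1 : Matrix ι ι R) a l) ∧ (h * g) k k = 1 := by
  have hadd : ∀ g : SpecialLinearGroup ι R, (∀ l ∉ S, ∀ a, g a l = (1 : Matrix ι ι R) a l) →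
      ∀ i j, j ∈ S → i ≠ j → IsUnit (g j k) → ∃ h ∈ H,
      (∀ l ∉ S, ∀ a, (h * g) a l = (1 : Matrix ι ι R) a l) ∧ (h * g) i k = 1 := by
    intro g hg i j hj hij hu
    obtain ⟨w, hw⟩ := hu
    obtain ⟨h, hh, e⟩ := (hH i j hij ((1 - g i k) * (w⁻¹ : Rˣ))).exists_mul_apply g
    refine ⟨h, hh, fun l hl a => ?_, ?_⟩
    · rw [e, hg l hl, hg l hl, Matrix.one_apply_ne (i := j) (by rintro rfl; exact hl hj)]
      simp
    · rw [e, ← hw]; simp [mul_assoc]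
  obtain ⟨h, hh, hS, j, hj, hu⟩ := hH.exists_isUnit S hk g hg
  by_cases hkj : k = j
  · subst hkj
    by_cases hi : ∃ i ∈ S, i ≠ k
    · obtain ⟨i, hi, hik⟩ := hi
      obtain ⟨h1, hh1, hS1, e1⟩ := hadd _ hS i k hk hik hu
      obtain ⟨h2, hh2, hS2, e2⟩ := hadd _ hS1 k i hi hik.symm
        (isUnit_iff_exists.2 ⟨1, by simp [e1]⟩)
      exact ⟨h2 * h1 * h, mul_mem (mul_mem hh2 hh1) hh, by simpa only [mul_assoc] using hS2,
        by simpa only [mul_assoc] using e2⟩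
    · push Not at hi
      refine ⟨1, one_mem _, by simpa using hg, ?_⟩
      have hg1 : (g : Matrix ι ι R) =
          1 + vecMulVec (fun a => g a k - (1 : Matrix ι ι R) a k) (Pi.single k 1) := by
        ext a l
        by_cases hl : l = k
        · subst hl; simp [vecMulVec_apply]
        · rw [hg l (fun h => hl (hi l h))]; simp [vecMulVec_apply, hl]
      have := g.det_coe
      rw [hg1, det_one_add_vecMulVec] at this
      simpa using this
  · obtain ⟨h1, hh1, hS1, e1⟩ := hadd _ hS k j hj hkj hu
    exact ⟨h1 * h, mul_mem hh1 hh, by simpa only [mul_assoc] using hS1,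
      by simpa only [mul_assoc] using e1⟩

/-- Over a Euclidean domain, the special linear group is generated by elementary
transvections. -/
theorem HasElementary.eq_top (hH : HasElementary H) : H = ⊤ := by
  have key : ∀ (S : Finset ι) (g : SpecialLinearGroup ι R),
      (∀ l ∉ S, ∀ a, g a l = (1 : Matrix ι ι R) a l) → g ∈ H := by
    intro S
    induction S using Finset.induction_on with
    | empty =>
      intro g hg
      have : g = 1 := by ext a l; simpa using hg l (by simp) a
      rw [this]; exact one_mem _
    | insert k S hk ih =>
      intro g hg
      obtain ⟨h, hh, hS, e⟩ := hH.exists_eq_one (insert k S) (Finset.mem_insert_self k S) g hg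
      have hx : HasTransvection H (fun a => if a = k then 0 else -(h * g) a k)
          (Pi.single k 1) := by
        rw [← mem_vectors, ← Finset.univ_sum_single (fun a => if a = k then 0 else -(h * g) a k)]
        refine sum_mem fun i _ => ?_
        by_cases hik : i = k
        · simp only [hik, if_true, Pi.single_zero]; exact zero_mem _
        · rw [if_neg hik, mem_vectors, HasTransvection]
          have := hH i k hik (-(h * g) i k)
          rw [HasTransvection] at this
          convert this using 1
          ext a b
          simp only [vecMulVec_apply, Pi.single_apply]
          split_ifs <;> simp
      obtain ⟨h', hh', e'⟩ := hx.exists_mul_apply (h * g)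
      have hmem : h' * (h * g) ∈ H := by
        refine ih _ fun l hl a => ?_
        rw [e']
        by_cases hlk : l = k
        · subst hlk
          rw [e]
          by_cases ha : a = l
          · rw [ha, e]; simp
          · simp [ha]
        · have hl' : l ∉ insert k S := by simp [hlk, hl]
          rw [hS l hl', hS l hl', Matrix.one_apply_ne' hlk]; simp
      rw [← mul_assoc] at hmem
      exact (Subgroup.mul_mem_cancel_left _ (mul_mem hh' hh)).1 hmem
  rw [eq_top_iff]
  exact fun g _ => key Finset.univ g (by simp)

end Generation

section FiniteIndex

variable {ι : Type*} [Fintype ι] [DecidableEq ι]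

section Suslin

variable {F : Subgroup (SpecialLinearGroup ι ℤ)} {q : ℤ}

lemma HasTransvection.smul_right {x ψ : ι → ℤ} (h : HasTransvection F x ψ) (k : ℤ) :
    HasTransvection F x (k • ψ) :=
  (covectors F x).zsmul_mem h k

lemma HasTransvection.smul_left {x ψ : ι → ℤ} (h : HasTransvection F x ψ) (k : ℤ) :
    HasTransvection F (k • x) ψ :=
  (vectors F ψ).zsmul_mem h k

/-- The subgroup `F` contains the elementary transvections with entry `q`. -/
def HasElementaryLevel (F : Subgroup (SpecialLinearGroup ι ℤ)) (q : ℤ) : Prop :=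
  ∀ i j : ι, i ≠ j → HasTransvection F (Pi.single i 1) (Pi.single j q)

lemma HasElementaryLevel.single (hF : HasElementaryLevel F q) {k : ι} {ψ : ι → ℤ}
    (hψ : ψ k = 0) : HasTransvection F (Pi.single k 1) (q • ψ) := by
  rw [← mem_covectors, ← Finset.univ_sum_single (q • ψ)]
  refine sum_mem fun i _ => ?_
  by_cases hik : k = i
  · subst hik; simp [hψ, zero_mem]
  · have := (hF k i hik).smul_right (ψ i)
    rw [← Pi.single_smul] at this
    simpa [mul_comm, mem_covectors] using this

lemma HasElementaryLevel.suslin (hF : HasElementaryLevel F q)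
    (h3 : ∀ i j : ι, ∃ k, k ≠ i ∧ k ≠ j) {x ψ y : ι → ℤ} (hy : y ⬝ᵥ x = 1) (hψ : ψ ⬝ᵥ x = 0) :
    HasTransvection F x (q ^ 2 • ψ) := by
  set ω : ι → ι → ι → ℤ := fun i j => Pi.single j (x i) - Pi.single i (x j) with hω
  have hsum : ψ = ∑ i, ∑ j, (y i * ψ j) • ω i j := by
    have e1 : ∑ i, ∑ j, (y i * ψ j) • ω i j = (y ⬝ᵥ x) • ψ - (ψ ⬝ᵥ x) • y := by
      ext k
      simp only [hω, smul_sub, Finset.sum_sub_distrib, Finset.sum_apply, Pi.sub_apply,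
        Pi.smul_apply, Pi.single_apply, smul_eq_mul, mul_ite, mul_zero, dotProduct,
        Finset.sum_mul]
      congr 1
      · refine Finset.sum_congr rfl fun i _ => ?_
        simp; ring
      · rw [Finset.sum_comm]
        refine Finset.sum_congr rfl fun i _ => ?_
        simp; ring
    rw [e1, hy, hψ]; simp
  have key : ∀ i j, HasTransvection F x (q ^ 2 • ω i j) := by
    intro i j
    by_cases hij : i = j
    · subst hij
      simp only [hω, sub_self, smul_zero]
      exact zero_mem (covectors F x)
    have hω0 : ∀ k, k ≠ i → k ≠ j → ω i j k = 0 := fun k hi hj => by simp [hω, hi, hj]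
    obtain ⟨k, hki, hkj⟩ := h3 i j
    have h1 : HasTransvection F (Pi.single i (x i) + Pi.single j (x j)) (q ^ 2 • ω i j) := by
      have a1 : HasTransvection F (Pi.single i (x i) + Pi.single j (x j)) (Pi.single k q) := by
        have b1 := (hF i k hki.symm).smul_left (x i)
        have b2 := (hF j k hkj.symm).smul_left (x j)
        rw [← Pi.single_smul, smul_eq_mul, mul_one] at b1 b2
        exact b1.add_left b2
      have a2 : HasTransvection F (Pi.single k 1) (q • ω i j) := hF.single (hω0 k hki hkj)
      have := a1.comm a2 (by
        simp [hω, hij, Ne.symm hij, dotProduct_add]; ring)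
      simpa [smul_smul, sq, mul_assoc] using this
    have h2 : ∀ k, k ≠ i → k ≠ j →
        HasTransvection F (Pi.single k (x k)) (q ^ 2 • ω i j) := by
      intro k hki hkj
      have a := ((hF.single (hω0 k hki hkj)).smul_right q).smul_left (x k)
      rw [← Pi.single_smul, smul_eq_mul, mul_one, smul_smul, ← sq] at a
      exact a
    have hx : x = (Pi.single i (x i) + Pi.single j (x j)) +
        ∑ k ∈ (Finset.univ.erase i).erase j, Pi.single k (x k) := by
      conv_lhs => rw [← Finset.univ_sum_single x]
      rw [← Finset.add_sum_erase _ _ (Finset.mem_univ i),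
        ← Finset.add_sum_erase (Finset.univ.erase i) _ (a := j) (by simp [Ne.symm hij]), add_assoc]
    have h4 : HasTransvection F (∑ k ∈ (Finset.univ.erase i).erase j, Pi.single k (x k))
        (q ^ 2 • ω i j) :=
      sum_mem (S := vectors F (q ^ 2 • ω i j)) fun k hk => by
        simp only [Finset.mem_erase] at hk
        exact h2 k hk.2.1 hk.1
    rw [hx]
    convert h1.add_left h4 using 2
  rw [hsum, Finset.smul_sum]
  refine sum_mem (S := covectors F x) fun i _ => ?_
  rw [Finset.smul_sum]
  refine sum_mem fun j _ => ?_
  rw [smul_comm]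
  exact (key i j).smul_right _

end Suslin

lemma exists_isCoprime_add_mul {a b g : ℤ} (hg : g ≠ 0)
    (h : ∀ p : ℤ, Prime p → p ∣ a → p ∣ b → ¬ p ∣ g) : ∃ t : ℤ, IsCoprime (a + t * b) g := by
  classical
  set s : Finset ℕ := g.natAbs.primeFactors.filter fun p => ¬ (p : ℤ) ∣ a with hs
  refine ⟨∏ p ∈ s, ((p : ℕ) : ℤ), ?_⟩
  refine isCoprime_of_prime_dvd (fun h => hg h.2) fun p hp h1 h2 => ?_
  have hp' : p.natAbs.Prime := Int.prime_iff_natAbs_prime.1 hp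
  by_cases hpa : p ∣ a
  · have h3 : p ∣ (∏ p ∈ s, ((p : ℕ) : ℤ)) * b := (dvd_add_right hpa).1 h1
    rcases hp.dvd_or_dvd h3 with h4 | h4
    · obtain ⟨r, hr, hpr⟩ := (hp.dvd_finsetProd_iff _).1 h4
      simp only [hs, Finset.mem_filter, Nat.mem_primeFactors] at hr
      have : p.natAbs = r :=
        (Nat.prime_dvd_prime_iff_eq hp' hr.1.1).1
          (Int.natAbs_dvd.2 hpr |> Int.natCast_dvd_natCast.1)
      exact hr.2 (by rw [← this]; simpa using hpa)
    · exact h p hp hpa h4 h2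
  · have hmem : p.natAbs ∈ s := by
      simp only [hs, Finset.mem_filter, Nat.mem_primeFactors]
      exact ⟨⟨hp', Int.natAbs_dvd_natAbs.2 h2, by simpa using hg⟩, by simpa using hpa⟩
    have h3 : p ∣ ∏ p ∈ s, ((p : ℕ) : ℤ) :=
      (Int.dvd_natAbs.2 dvd_rfl).trans (Finset.dvd_prod_of_mem (fun p : ℕ => (p : ℤ)) hmem)
    exact hpa ((dvd_add_left (h3.mul_right b)).1 h1)


section Congruence

lemma exists_dotProduct_mulVec_eq_one {R : Type*} [CommRing R] (f : SpecialLinearGroup ι R)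
    {c y : ι → R} (hy : y ⬝ᵥ c = 1) : ∃ y', y' ⬝ᵥ ((f : Matrix ι ι R) *ᵥ c) = 1 := by
  refine ⟨y ᵥ* ((f⁻¹ : SpecialLinearGroup ι R) : Matrix ι ι R), ?_⟩
  rw [dotProduct_mulVec, vecMul_vecMul, ← Matrix.SpecialLinearGroup.coe_mul, inv_mul_cancel,
    Matrix.SpecialLinearGroup.coe_one, vecMul_one, hy]

variable {E : Subgroup (SpecialLinearGroup ι ℤ)} {p : ℤ}

lemma HasElementaryLevel.exists_mulVec_add_single (hE : HasElementaryLevel E p) {i i₀ : ι}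
    (hi : i ≠ i₀) {c d : ι → ℤ} (hc : c = Pi.single i₀ 1 + p ^ 2 • d) (t : ℤ) :
    ∃ f ∈ E, (f : Matrix ι ι ℤ) *ᵥ c = Pi.single i₀ 1 + p ^ 2 • (d + Pi.single i (t * c i₀)) := by
  have h1 : HasTransvection E (Pi.single i 1) (Pi.single i₀ (p ^ 2 * t)) := by
    have := (hE i i₀ hi).smul_right (p * t)
    rw [← Pi.single_smul] at this
    have e : p ^ 2 * t = (p * t) • p := by rw [smul_eq_mul]; ring
    rwa [e]
  obtain ⟨f, hf, e⟩ := h1.exists_mulVec c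
  refine ⟨f, hf, ?_⟩
  rw [e]
  ext k
  rw [hc]
  by_cases hk : k = i
  · subst hk; simp [hi]; ring
  · simp [hk]

lemma HasElementaryLevel.exists_mulVec_eq_single_of_dotProduct (hE : HasElementaryLevel E p)
    (h3 : ∀ i j : ι, ∃ k, k ≠ i ∧ k ≠ j) {i₀ : ι} {c d ρ : ι → ℤ}
    (hc : c = Pi.single i₀ 1 + p ^ 2 • d) (hρ : ρ i₀ = 0) (hρd : ρ ⬝ᵥ d = 1) :
    ∃ f ∈ E, (f : Matrix ι ι ℤ) *ᵥ c = Pi.single i₀ 1 := by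
  have h0 : (d i₀ • ρ - Pi.single i₀ 1) ⬝ᵥ d = 0 := by
    rw [sub_dotProduct, smul_dotProduct, hρd]; simp
  obtain ⟨f, hf, e⟩ := (hE.suslin h3 hρd h0).exists_mulVec c
  refine ⟨f, hf, ?_⟩
  have h1 : (d i₀ • ρ - Pi.single i₀ 1) ⬝ᵥ c = -1 := by
    rw [hc, dotProduct_add, dotProduct_smul, h0, sub_dotProduct, smul_dotProduct]
    simp [hρ]
  rw [e, smul_dotProduct, h1, hc]
  simp

lemma HasElementaryLevel.exists_mulVec_eq_single_of_ne (hE : HasElementaryLevel E p)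
    (h3 : ∀ i j : ι, ∃ k, k ≠ i ∧ k ≠ j) {i₀ i₁ : ι} (h01 : i₁ ≠ i₀) {c d y : ι → ℤ}
    (hc : c = Pi.single i₀ 1 + p ^ 2 • d) (hy : y ⬝ᵥ c = 1) (hd : d i₁ ≠ 0) :
    ∃ f ∈ E, (f : Matrix ι ι ℤ) *ᵥ c = Pi.single i₀ 1 := by
  obtain ⟨i₂, h20, h21⟩ := h3 i₀ i₁
  set d' : ι → ℤ := fun i => if i = i₀ ∨ i = i₂ then 0 else d i with hd'
  set J : Submodule ℤ ℤ := LinearMap.range (Fintype.linearCombination ℤ d') with hJ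
  set g := Submodule.IsPrincipal.generator J with hg
  have hdvd : ∀ i, i ≠ i₀ → i ≠ i₂ → g ∣ d i := by
    intro i h0 h2
    refine (Submodule.IsPrincipal.mem_iff_generator_dvd J).1 ⟨Pi.single i 1, ?_⟩
    rw [Fintype.linearCombination_apply_single]
    simp [hd', h0, h2]
  have hg0 : g ≠ 0 := fun h => hd (by simpa [h] using hdvd i₁ h01 h21.symm)
  obtain ⟨σ, hσ⟩ : ∃ σ : ι → ℤ, σ ⬝ᵥ d' = g := by
    obtain ⟨σ, hσ⟩ := Submodule.IsPrincipal.generator_mem J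
    exact ⟨σ, by rw [hg, ← hσ]; simp [Fintype.linearCombination_apply, dotProduct]⟩
  set σ' : ι → ℤ := fun i => if i = i₀ ∨ i = i₂ then 0 else σ i with hσ'
  have hσd : σ' ⬝ᵥ d = g := by
    rw [← hσ]
    refine Finset.sum_congr rfl fun i _ => ?_
    simp only [hσ', hd']
    split_ifs <;> simp
  obtain ⟨t, ht⟩ : ∃ t : ℤ, IsCoprime (d i₂ + t * c i₀) g := by
    refine exists_isCoprime_add_mul hg0 fun r hr h2 h0 hrg => hr.not_isUnit ?_
    refine isUnit_of_dvd_one ?_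
    rw [← hy]
    refine Finset.dvd_sum fun i _ => Dvd.dvd.mul_left ?_ _
    by_cases hi0 : i = i₀
    · rwa [hi0]
    have : c i = p ^ 2 * d i := by rw [hc]; simp [hi0]
    rw [this]
    refine Dvd.dvd.mul_left ?_ _
    by_cases hi2 : i = i₂
    · rwa [hi2]
    · exact hrg.trans (hdvd i hi0 hi2)
  obtain ⟨a, b, hab⟩ := ht
  obtain ⟨f, hf, e⟩ := hE.exists_mulVec_add_single h20 hc t
  obtain ⟨f', hf', e'⟩ := hE.exists_mulVec_eq_single_of_dotProduct h3 e
    (ρ := b • σ' + Pi.single i₂ a) (by simp [hσ', h20.symm]) (by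
      have hz : σ' i₂ = 0 := by simp [hσ']
      rw [dotProduct_add, add_dotProduct, smul_dotProduct, hσd, add_dotProduct, smul_dotProduct,
        ← hab]
      simp [hz]; ring)
  exact ⟨f' * f, mul_mem hf' hf, by
    rw [Matrix.SpecialLinearGroup.coe_mul, ← mulVec_mulVec, e']⟩

/-- A unimodular column congruent to a standard basis vector can be moved to that basis vector
by a group of transvections of the corresponding level. -/
lemma HasElementaryLevel.exists_mulVec_eq_single (hE : HasElementaryLevel E p) (hp : 2 ≤ p)
    (h3 : ∀ i j : ι, ∃ k, k ≠ i ∧ k ≠ j) {i₀ : ι} {c d y : ι → ℤ}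
    (hc : c = Pi.single i₀ 1 + p ^ 2 • d) (hy : y ⬝ᵥ c = 1) :
    ∃ f ∈ E, (f : Matrix ι ι ℤ) *ᵥ c = Pi.single i₀ 1 := by
  obtain ⟨i₁, h10, -⟩ := h3 i₀ i₀
  by_cases hd : d i₁ = 0
  · obtain ⟨f, hf, e⟩ := hE.exists_mulVec_add_single h10 hc 1
    obtain ⟨y', hy'⟩ := exists_dotProduct_mulVec_eq_one f hy
    have hne : (d + Pi.single i₁ (1 * c i₀) : ι → ℤ) i₁ ≠ 0 := by
      simp only [Pi.add_apply, hd, Pi.single_eq_same, zero_add, one_mul]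
      intro h0
      have : 1 + p ^ 2 * d i₀ = 0 := by rw [← h0, hc]; simp
      have h1 : p ∣ 1 := ⟨-(p * d i₀), by linear_combination this⟩
      have := Int.le_of_dvd one_pos h1
      omega
    obtain ⟨f', hf', e'⟩ := hE.exists_mulVec_eq_single_of_ne h3 h10 e hy' hne
    exact ⟨f' * f, mul_mem hf' hf, by
      rw [Matrix.SpecialLinearGroup.coe_mul, ← mulVec_mulVec, e']⟩
  · exact hE.exists_mulVec_eq_single_of_ne h3 h10 hc hy hd

/-- The principal congruence subgroup of level `m`. -/
def congruence (ι : Type*) [Fintype ι] [DecidableEq ι] (m : ℕ) :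
    Subgroup (SpecialLinearGroup ι ℤ) :=
  (Matrix.SpecialLinearGroup.map (n := ι) (Int.castRingHom (ZMod m))).ker

lemma mem_congruence {m : ℕ} {g : SpecialLinearGroup ι ℤ} :
    g ∈ congruence ι m ↔ ∃ M : Matrix ι ι ℤ, (g : Matrix ι ι ℤ) = 1 + (m : ℤ) • M := by
  have h1 : g ∈ congruence ι m ↔ ∀ i j, ((g i j : ℤ) : ZMod m) = ((1 : Matrix ι ι ℤ) i j : ℤ) := by
    rw [congruence, MonoidHom.mem_ker, Matrix.SpecialLinearGroup.ext_iff]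
    refine forall₂_congr fun i j => ?_
    rw [Matrix.SpecialLinearGroup.map_apply_coe, Matrix.SpecialLinearGroup.coe_one]
    simp [Matrix.one_apply]
  rw [h1]
  constructor
  · intro h
    have h2 : ∀ i j, ∃ M : ℤ, g i j = (1 : Matrix ι ι ℤ) i j + m * M := by
      intro i j
      obtain ⟨M, hM⟩ := (ZMod.intCast_eq_intCast_iff_dvd_sub _ _ _).1 (h i j).symm
      exact ⟨M, by rw [← hM]; ring⟩
    choose M hM using h2
    exact ⟨Matrix.of M, by ext i j; rw [hM, Matrix.add_apply, Matrix.smul_apply]; simp⟩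
  · rintro ⟨M, hM⟩ i j
    rw [hM, Matrix.add_apply, Matrix.smul_apply]; simp

instance (m : ℕ) [NeZero m] : (congruence ι m).FiniteIndex := by
  rw [congruence]; infer_instance

instance (m : ℕ) : (congruence ι m).Normal := by
  rw [congruence]; infer_instance

end Congruence


lemma finite_of_finiteIndex_center {G : Type*} [Group G] [(Subgroup.center G).FiniteIndex]
    (h : commutator G = ⊤) : Finite G := by
  have hfin : Finite (commutatorSet G) := by
    refine Set.Finite.subset (Set.finite_range fun p : (G ⧸ Subgroup.center G) ×
      (G ⧸ Subgroup.center G) => p.1.out * p.2.out * p.1.out⁻¹ * p.2.out⁻¹) ?_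
    rintro _ ⟨a, b, rfl⟩
    refine ⟨(a, b), ?_⟩
    obtain ⟨z, hz⟩ := QuotientGroup.mk_out_eq_mul (Subgroup.center G) a
    obtain ⟨w, hw⟩ := QuotientGroup.mk_out_eq_mul (Subgroup.center G) b
    have hzc := Subgroup.mem_center_iff.1 z.2
    have hwc := Subgroup.mem_center_iff.1 w.2
    simp only [hz, hw]
    change a * z * (b * w) * (a * z)⁻¹ * (b * w)⁻¹ = a * b * a⁻¹ * b⁻¹
    calc a * z * (b * w) * (a * z)⁻¹ * (b * w)⁻¹
        = a * (z * (b * w) * (z : G)⁻¹) * a⁻¹ * (w : G)⁻¹ * b⁻¹ := by group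
      _ = a * b * (w * a⁻¹ * (w : G)⁻¹) * b⁻¹ := by
        rw [← hzc (b * w)]; group
      _ = a * b * a⁻¹ * b⁻¹ := by rw [← hwc a⁻¹]; group
  have : Finite (⊤ : Subgroup G) := h ▸ (inferInstance : Finite (commutator G))
  exact Finite.of_equiv _ Subgroup.topEquiv.toEquiv

lemma hasElementary_commutator (R : Type*) [CommRing R] (h3 : ∀ i j : ι, ∃ k, k ≠ i ∧ k ≠ j) :
    HasElementary (commutator (SpecialLinearGroup ι R)) := by
  intro i j hij t
  obtain ⟨k, hki, hkj⟩ := h3 i j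
  have h1 : HasTransvection (⊤ : Subgroup (SpecialLinearGroup ι R)) (Pi.single i 1)
    (Pi.single k t) := hasTransvection_top (by simp [hki.symm])
  have h2 : HasTransvection (⊤ : Subgroup (SpecialLinearGroup ι R)) (Pi.single k 1)
    (Pi.single j 1) := hasTransvection_top (by simp [hkj.symm])
  have := h1.commutator h2 (by simp [hij])
  rw [← Pi.single_smul] at this
  simpa [commutator_def] using this

section

variable {E : Subgroup (SpecialLinearGroup ι ℤ)} {p : ℕ}

lemma HasElementaryLevel.mk_mem_center [E.Normal] (hE : HasElementaryLevel E p)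
    (hle : E ≤ congruence ι p) (hp : 2 ≤ p)
    (h3 : ∀ i j : ι, ∃ k, k ≠ i ∧ k ≠ j) {g : SpecialLinearGroup ι ℤ}
    (hg : g ∈ congruence ι (p ^ 2)) : (QuotientGroup.mk g : SpecialLinearGroup ι ℤ ⧸ E) ∈
      Subgroup.center (SpecialLinearGroup ι ℤ ⧸ E) := by
  have key : HasElementary ((Subgroup.centralizer
      {(QuotientGroup.mk g : SpecialLinearGroup ι ℤ ⧸ E)}).comap (QuotientGroup.mk' E)) := by
    intro i j hij t
    obtain ⟨τ, -, hτ⟩ := hasTransvection_top (R := ℤ) (x := Pi.single i 1) (ψ := Pi.single j t)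
      (by simp [hij])
    refine ⟨τ, ?_, hτ⟩
    obtain ⟨M, hM⟩ := mem_congruence.1 hg
    obtain ⟨y, hy⟩ := exists_dotProduct_mulVec_eq_one g
      (c := (Pi.single i 1 : ι → ℤ)) (y := Pi.single i 1) (by simp)
    obtain ⟨f, hf, e⟩ := hE.exists_mulVec_eq_single (by exact_mod_cast hp) h3
      (c := (g : Matrix ι ι ℤ) *ᵥ Pi.single i 1) (d := M *ᵥ Pi.single i 1) (i₀ := i)
      (by rw [hM, add_mulVec, one_mulVec, smul_mulVec]; push_cast; rfl) hy
    have hfg : f * g ∈ congruence ι p := by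
      refine mul_mem (hle hf) (mem_congruence.2 ⟨(p : ℤ) • M, ?_⟩)
      rw [hM, smul_smul]; push_cast; rw [sq]
    obtain ⟨M', hM'⟩ := mem_congruence.1 (inv_mem hfg)
    rw [mulVec_mulVec, ← Matrix.SpecialLinearGroup.coe_mul] at e
    have hMi : M' *ᵥ Pi.single i 1 = 0 := by
      have h1 : (((f * g)⁻¹ : SpecialLinearGroup ι ℤ) : Matrix ι ι ℤ) *ᵥ Pi.single i 1 =
          Pi.single i 1 := by
        conv_lhs => rw [← e]
        rw [mulVec_mulVec, ← Matrix.SpecialLinearGroup.coe_mul, inv_mul_cancel,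
          Matrix.SpecialLinearGroup.coe_one, one_mulVec]
      rw [hM', add_mulVec, one_mulVec, smul_mulVec, add_eq_left] at h1
      exact (smul_eq_zero.1 h1).resolve_left (by exact_mod_cast (by omega : p ≠ 0))
    have hψ : (Pi.single j t ᵥ* M') i = 0 := by
      have := dotProduct_mulVec (Pi.single j t) M' (Pi.single i 1)
      rw [hMi, dotProduct_zero] at this
      simpa using this.symm
    obtain ⟨k, hk, ek⟩ := hE.single hψ
    have hconj : f * g * τ * (f * g)⁻¹ = k * τ := by
      refine Subtype.ext ?_
      rw [Matrix.SpecialLinearGroup.coe_mul, Matrix.SpecialLinearGroup.coe_mul _ τ,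
        Matrix.SpecialLinearGroup.coe_mul k τ, hτ, ek, mul_add, add_mul, mul_one, mul_vecMulVec,
        e, ← Matrix.SpecialLinearGroup.coe_mul, mul_inv_cancel, Matrix.SpecialLinearGroup.coe_one,
        hM', mul_add, add_mul, mul_one, one_mul, mul_add, mul_one, vecMulVec_mul_vecMulVec,
        vecMulVec_mul,
        vecMul_smul, smul_dotProduct, dotProduct_single, hψ]
      simp [add_assoc, add_comm]
    have h1 := congr_arg (QuotientGroup.mk (s := E)) hconj
    have hf1 : (QuotientGroup.mk f : SpecialLinearGroup ι ℤ ⧸ E) = 1 :=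
      (QuotientGroup.eq_one_iff f).2 hf
    have hk1 : (QuotientGroup.mk k : SpecialLinearGroup ι ℤ ⧸ E) = 1 :=
      (QuotientGroup.eq_one_iff k).2 hk
    simp only [QuotientGroup.mk_mul, QuotientGroup.mk_inv, hf1, hk1, one_mul] at h1
    exact Subgroup.mem_centralizer_singleton_iff.2 (mul_inv_eq_iff_eq_mul.1 h1).symm
  rw [Subgroup.mem_center_iff]
  intro x
  obtain ⟨h, rfl⟩ := QuotientGroup.mk_surjective x
  have : h ∈ (Subgroup.centralizer
      {(QuotientGroup.mk g : SpecialLinearGroup ι ℤ ⧸ E)}).comap (QuotientGroup.mk' E) := by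
    rw [key.eq_top]; trivial
  exact (Subgroup.mem_centralizer_singleton_iff.1 this)

end

/-- A subgroup of `SL(n,ℤ)`, `n ≥ 3`, containing the `q`-th powers of the elementary
transvections has finite index. -/
theorem HasElementaryLevel.finiteIndex {F : Subgroup (SpecialLinearGroup ι ℤ)} {q : ℕ}
    (hF : HasElementaryLevel F q) (hq : 2 ≤ q) (h3 : ∀ i j : ι, ∃ k, k ≠ i ∧ k ≠ j) :
    F.FiniteIndex := by
  set S : Set (SpecialLinearGroup ι ℤ) := {g | ∃ i j, i ≠ j ∧
    (g : Matrix ι ι ℤ) = 1 + vecMulVec (Pi.single i 1) (Pi.single j ((q ^ 2 : ℕ) : ℤ))} with hS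
  have hSF : Subgroup.normalClosure S ≤ F := by
    rw [Subgroup.normalClosure, Subgroup.closure_le]
    intro g hg
    obtain ⟨s, ⟨i, j, hij, e⟩, hs⟩ := Group.mem_conjugatesOfSet_iff.1 hg
    obtain ⟨k, rfl⟩ := isConj_iff.1 hs
    have h1 : HasTransvection (⊤ : Subgroup (SpecialLinearGroup ι ℤ)) (Pi.single i 1)
        (Pi.single j 1) := hasTransvection_top (by simp [hij])
    obtain ⟨y, hy⟩ := exists_dotProduct_mulVec_eq_one k
      (c := (Pi.single i 1 : ι → ℤ)) (y := Pi.single i 1) (by simp)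
    obtain ⟨f, hf, e'⟩ := hF.suslin h3 hy (h1.conj (Subgroup.mem_top k)).dotProduct_eq
    have : k * s * k⁻¹ = f := by
      refine Subtype.ext ?_
      rw [e', Matrix.SpecialLinearGroup.coe_mul, Matrix.SpecialLinearGroup.coe_mul, e, mul_add,
        add_mul, mul_one, mul_vecMulVec, vecMulVec_mul, ← Matrix.SpecialLinearGroup.coe_mul,
        mul_inv_cancel, Matrix.SpecialLinearGroup.coe_one, ← smul_vecMul, ← Pi.single_smul]
      simp
    rwa [this]
  have hE : HasElementaryLevel (Subgroup.normalClosure S) (q ^ 2 : ℕ) := by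
    intro i j hij
    obtain ⟨g, -, e⟩ := hasTransvection_top (R := ℤ) (x := Pi.single i 1)
      (ψ := Pi.single j ((q ^ 2 : ℕ) : ℤ)) (by simp [hij])
    exact ⟨g, Subgroup.subset_normalClosure ⟨i, j, hij, e⟩, e⟩
  have hle : Subgroup.normalClosure S ≤ congruence ι (q ^ 2) := by
    refine Subgroup.normalClosure_le_normal fun g hg => ?_
    obtain ⟨i, j, -, e⟩ := hg
    refine mem_congruence.2 ⟨vecMulVec (Pi.single i 1) (Pi.single j 1), ?_⟩
    rw [e, ← vecMulVec_smul, ← Pi.single_smul]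
    simp
  have hc : (Subgroup.center (SpecialLinearGroup ι ℤ ⧸ Subgroup.normalClosure S)).FiniteIndex := by
    have : NeZero ((q ^ 2) ^ 2) := ⟨by positivity⟩
    have h1 : congruence ι ((q ^ 2) ^ 2) ≤ (Subgroup.center (SpecialLinearGroup ι ℤ ⧸
        Subgroup.normalClosure S)).comap (QuotientGroup.mk' _) :=
      fun g hg => hE.mk_mem_center hle (by nlinarith) h3 hg
    have := Subgroup.finiteIndex_of_le h1
    constructor
    rw [← Subgroup.index_comap_of_surjective _ (QuotientGroup.mk'_surjective _)]
    exact this.index_ne_zero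
  have : Finite (SpecialLinearGroup ι ℤ ⧸ Subgroup.normalClosure S) := by
    refine finite_of_finiteIndex_center ?_
    have h1 := (hasElementary_commutator (ι := ι) ℤ h3).eq_top
    have h2 := QuotientGroup.mk'_surjective (Subgroup.normalClosure S)
    rw [commutator_def] at h1 ⊢
    rw [← Subgroup.map_top_of_surjective _ h2, ← Subgroup.map_commutator, h1]
  have := Subgroup.finiteIndex_of_finite_quotient (H := Subgroup.normalClosure S)
  exact Subgroup.finiteIndex_of_le hSF

end FiniteIndex

section Transitivity

variable {ι R K : Type*}

/-- The vectors `x` and `y` are not proportional. -/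
def Indep [Mul R] (x y : ι → R) : Prop := ∃ i j, x i * y j ≠ x j * y i

lemma Indep.symm [CommRing R] {x y : ι → R} (h : Indep x y) : Indep y x := by
  obtain ⟨i, j, h⟩ := h
  exact ⟨i, j, fun e => h (by linear_combination -e)⟩

lemma indep_of_dotProduct [Fintype ι] [CommRing R] [IsDomain R] {φ x y : ι → R} (hx : x ≠ 0)
    (h0 : φ ⬝ᵥ x = 0) (h1 : φ ⬝ᵥ y ≠ 0) : Indep x y := by
  by_contra h
  simp only [Indep, not_exists, not_not] at h
  obtain ⟨i, hi⟩ := Function.ne_iff.1 hx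
  refine h1 ((mul_eq_zero.1 (?_ : x i * (φ ⬝ᵥ y) = 0)).resolve_left hi)
  calc x i * (φ ⬝ᵥ y) = (φ ⬝ᵥ x) * y i := by
        simp only [dotProduct, Finset.mul_sum, Finset.sum_mul]
        exact Finset.sum_congr rfl fun j _ => by linear_combination φ j * h i j
    _ = 0 := by rw [h0, zero_mul]

lemma Indep.exists_dotProduct [Fintype ι] [DecidableEq ι] [CommRing R] {φ χ : ι → R}
    (h : Indep φ χ) : ∃ z, φ ⬝ᵥ z = 0 ∧ χ ⬝ᵥ z ≠ 0 := by
  obtain ⟨i, j, h⟩ := h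
  refine ⟨φ i • Pi.single j 1 - φ j • Pi.single i 1, ?_, ?_⟩
  · simp [dotProduct_sub, dotProduct_smul, mul_comm]
  · simpa [dotProduct_sub, dotProduct_smul, sub_eq_zero] using h

variable [Field K]

lemma Indep.linearIndependent {x y : ι → K} (h : Indep x y) : LinearIndependent K ![x, y] := by
  obtain ⟨i, j, h⟩ := h
  rw [LinearIndependent.pair_iff]
  intro s t hst
  have hi := congr_fun hst i
  have hj := congr_fun hst j
  simp only [Pi.add_apply, Pi.smul_apply, smul_eq_mul, Pi.zero_apply] at hi hj
  have h' : x i * y j - x j * y i ≠ 0 := sub_ne_zero.2 h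
  constructor
  · refine (mul_eq_zero.1 (?_ : s * (x i * y j - x j * y i) = 0)).resolve_right h'
    linear_combination y j * hi - y i * hj
  · refine (mul_eq_zero.1 (?_ : t * (x i * y j - x j * y i) = 0)).resolve_right h'
    linear_combination x i * hj - x j * hi

variable [Fintype ι] [DecidableEq ι]

/-- `SL(n)` acts transitively on pairs of independent vectors when `n ≥ 3`. -/
lemma exists_mulVec_pair (h3 : 3 ≤ Fintype.card ι) {a c a' c' : ι → K} (h : Indep a c)
    (h' : Indep a' c') : ∃ M : SpecialLinearGroup ι K,
      (M : Matrix ι ι K) *ᵥ a = a' ∧ (M : Matrix ι ι K) *ᵥ c = c' := by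
  have hb := h.linearIndependent
  have hb' := h'.linearIndependent
  set W := Submodule.span K (Set.range ![a, c])
  set W' := Submodule.span K (Set.range ![a', c'])
  obtain ⟨g, hg⟩ := Submodule.exists_linearEquiv_restrict_eq
    ((Module.Basis.span hb).equiv (Module.Basis.span hb') (Equiv.refl _))
  have key : ∀ i, g (![a, c] i) = ![a', c'] i := by
    intro i
    have h1 := hg (Module.Basis.span hb i)
    rw [Module.Basis.equiv_apply, Module.Basis.span_apply, Module.Basis.span_apply] at h1
    exact h1.symm
  have hδ : (LinearMap.toMatrix' (g : (ι → K) →ₗ[K] (ι → K))).det ≠ 0 := by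
    rw [LinearMap.det_toMatrix']
    exact g.isUnit_det'.ne_zero
  set A := LinearMap.toMatrix' (g : (ι → K) →ₗ[K] (ι → K)) with hA
  have hlt : W' < ⊤ := by
    refine lt_top_iff_ne_top.2 fun htop => ?_
    have h1 := finrank_span_eq_card hb'
    have h2 : Module.finrank K W' = Module.finrank K (ι → K) := by rw [htop, finrank_top]
    rw [h1, Module.finrank_fintype_fun_eq_card, Fintype.card_fin] at h2
    omega
  obtain ⟨f, hf0, hf⟩ := Submodule.exists_le_ker_of_lt_top W' hlt
  set μ : ι → K := fun i => f (Pi.single i 1) with hμ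
  have hfμ : ∀ x, f x = μ ⬝ᵥ x := by
    intro x
    conv_lhs => rw [← Finset.univ_sum_single x, map_sum]
    refine Finset.sum_congr rfl fun i _ => ?_
    rw [← mul_one (x i), ← smul_eq_mul, Pi.single_smul, map_smul]
    simp [hμ, mul_comm]
  have hμ' : ∀ i, μ ⬝ᵥ (![a', c'] i) = 0 := fun i => by
    rw [← hfμ]; exact hf (Submodule.subset_span ⟨i, rfl⟩)
  obtain ⟨d, hd⟩ : ∃ d, f d ≠ 0 := by
    by_contra! h0
    exact hf0 (LinearMap.ext h0)
  have hdet : ((1 + vecMulVec (((A.det⁻¹ - 1) / f d) • d) μ) * A).det = 1 := by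
    rw [det_mul, det_one_add_vecMulVec, dotProduct_smul, ← hfμ, smul_eq_mul,
      div_mul_cancel₀ _ hd, add_sub_cancel, inv_mul_cancel₀ hδ]
  have hM : ∀ i, ((1 + vecMulVec (((A.det⁻¹ - 1) / f d) • d) μ) * A) *ᵥ (![a, c] i) =
      ![a', c'] i := by
    intro i
    have h1 : A *ᵥ (![a, c] i) = ![a', c'] i := by
      rw [← key i, hA]; exact LinearMap.toMatrix'_mulVec _ _
    rw [← mulVec_mulVec, h1, add_mulVec, vecMulVec_mulVec, hμ', one_mulVec]
    simp
  exact ⟨⟨_, hdet⟩, hM 0, hM 1⟩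

lemma exists_indep [CommRing R] [IsDomain R] (h3 : 3 ≤ Fintype.card ι) {x : ι → R} (hx : x ≠ 0) :
    ∃ y, Indep x y := by
  obtain ⟨i, hi⟩ := Function.ne_iff.1 hx
  have : Nontrivial ι := Fintype.one_lt_card_iff_nontrivial.1 (by omega)
  obtain ⟨j, hj⟩ := exists_ne i
  exact ⟨Pi.single j 1, i, j, by simpa [hj.symm] using hi⟩

lemma exists_mulVec (h3 : 3 ≤ Fintype.card ι) {a a' : ι → K} (ha : a ≠ 0)
    (ha' : a' ≠ 0) : ∃ M : SpecialLinearGroup ι K, (M : Matrix ι ι K) *ᵥ a = a' := by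
  obtain ⟨c, hc⟩ := exists_indep h3 ha
  obtain ⟨c', hc'⟩ := exists_indep h3 ha'
  obtain ⟨M, hM, -⟩ := exists_mulVec_pair h3 hc hc'
  exact ⟨M, hM⟩

lemma inv_mulVec_mulVec [CommRing R] (g : SpecialLinearGroup ι R) (x : ι → R) :
    ((g⁻¹ : SpecialLinearGroup ι R) : Matrix ι ι R) *ᵥ ((g : Matrix ι ι R) *ᵥ x) = x := by
  rw [mulVec_mulVec, ← Matrix.SpecialLinearGroup.coe_mul, inv_mul_cancel,
    Matrix.SpecialLinearGroup.coe_one, one_mulVec]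

end Transitivity

section Generic

variable {ι : Type*} [Fintype ι] [DecidableEq ι]

/-- Polynomial functions on matrices. -/
noncomputable def polyFun (ι : Type*) : Subalgebra ℚ (Matrix ι ι ℚ → ℚ) :=
  Algebra.adjoin ℚ (Set.range fun (q : ι × ι) (M : Matrix ι ι ℚ) => M q.1 q.2)

omit [Fintype ι] [DecidableEq ι] in
lemma mem_polyFun_iff {f : Matrix ι ι ℚ → ℚ} : f ∈ polyFun ι ↔
    ∃ p : MvPolynomial (ι × ι) ℚ, ∀ M, f M = MvPolynomial.aeval (fun q : ι × ι => M q.1 q.2) p := by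
  have h : ∀ p : MvPolynomial (ι × ι) ℚ, ∀ M : Matrix ι ι ℚ,
      MvPolynomial.aeval (fun (q : ι × ι) (M : Matrix ι ι ℚ) => M q.1 q.2) p M =
        MvPolynomial.aeval (fun q : ι × ι => M q.1 q.2) p := by
    intro p M
    have := MvPolynomial.map_aeval
      (fun (q : ι × ι) (M : Matrix ι ι ℚ) => M q.1 q.2) (Pi.evalRingHom (fun _ => ℚ) M) p
    simp only [Pi.evalRingHom_apply] at this
    rw [this, MvPolynomial.aeval_eq_eval₂Hom]
    rfl
  rw [polyFun, Algebra.adjoin_range_eq_range_aeval]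
  constructor
  · rintro ⟨p, rfl⟩
    exact ⟨p, fun M => h p M⟩
  · rintro ⟨p, hp⟩
    exact ⟨p, funext fun M => (h p M).trans (hp M).symm⟩

omit [Fintype ι] [DecidableEq ι] in
lemma entry_mem_polyFun (i j : ι) : (fun M : Matrix ι ι ℚ => M i j) ∈ polyFun ι :=
  Algebra.subset_adjoin ⟨(i, j), rfl⟩

omit [Fintype ι] [DecidableEq ι] in
lemma const_mem_polyFun (c : ℚ) : (fun _ : Matrix ι ι ℚ => c) ∈ polyFun ι :=
  (polyFun ι).algebraMap_mem c

omit [Fintype ι] [DecidableEq ι] in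
lemma add_mem_polyFun {f g : Matrix ι ι ℚ → ℚ} (hf : f ∈ polyFun ι) (hg : g ∈ polyFun ι) :
    (fun M => f M + g M) ∈ polyFun ι := add_mem hf hg

omit [Fintype ι] [DecidableEq ι] in
lemma sub_mem_polyFun {f g : Matrix ι ι ℚ → ℚ} (hf : f ∈ polyFun ι) (hg : g ∈ polyFun ι) :
    (fun M => f M - g M) ∈ polyFun ι := sub_mem hf hg

omit [Fintype ι] [DecidableEq ι] in
lemma mul_mem_polyFun {f g : Matrix ι ι ℚ → ℚ} (hf : f ∈ polyFun ι) (hg : g ∈ polyFun ι) :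
    (fun M => f M * g M) ∈ polyFun ι := mul_mem hf hg

omit [Fintype ι] [DecidableEq ι] in
lemma sum_mem_polyFun {κ : Type*} {s : Finset κ} {f : κ → Matrix ι ι ℚ → ℚ}
    (hf : ∀ k ∈ s, f k ∈ polyFun ι) : (fun M => ∑ k ∈ s, f k M) ∈ polyFun ι := by
  have := sum_mem hf
  convert this using 1
  ext M; simp

omit [Fintype ι] [DecidableEq ι] in
lemma prod_mem_polyFun {κ : Type*} {s : Finset κ} {f : κ → Matrix ι ι ℚ → ℚ}
    (hf : ∀ k ∈ s, f k ∈ polyFun ι) : (fun M => ∏ k ∈ s, f k M) ∈ polyFun ι := by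
  have := prod_mem hf
  convert this using 1
  ext M; simp

lemma det_mem_polyFun {F : Matrix ι ι ℚ → Matrix ι ι ℚ}
    (hF : ∀ i j, (fun M => F M i j) ∈ polyFun ι) : (fun M => (F M).det) ∈ polyFun ι := by
  simp only [det_apply']
  exact sum_mem_polyFun fun σ _ => mul_mem_polyFun (const_mem_polyFun _)
    (prod_mem_polyFun fun i _ => hF _ _)

lemma adjugate_mem_polyFun (i j : ι) : (fun M : Matrix ι ι ℚ => M.adjugate i j) ∈ polyFun ι := by
  simp only [adjugate_apply]
  refine det_mem_polyFun fun k l => ?_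
  simp only [updateRow_apply]
  split_ifs
  · exact const_mem_polyFun _
  · exact entry_mem_polyFun _ _

omit [DecidableEq ι] in
lemma mulVec_mem_polyFun {F : Matrix ι ι ℚ → Matrix ι ι ℚ} {x : Matrix ι ι ℚ → ι → ℚ}
    (hF : ∀ i j, (fun M => F M i j) ∈ polyFun ι) (hx : ∀ i, (fun M => x M i) ∈ polyFun ι) (i : ι) :
    (fun M => (F M *ᵥ x M) i) ∈ polyFun ι :=
  sum_mem_polyFun fun j _ => mul_mem_polyFun (hF i j) (hx j)

omit [DecidableEq ι] in
lemma dotProduct_mem_polyFun {x : Matrix ι ι ℚ → ι → ℚ} (ℓ : ι → ℚ)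
    (hx : ∀ i, (fun M => x M i) ∈ polyFun ι) :
    (fun M => ℓ ⬝ᵥ x M) ∈ polyFun ι :=
  sum_mem_polyFun fun j _ => mul_mem_polyFun (const_mem_polyFun _) (hx j)

omit [DecidableEq ι] in
lemma mul_right_mem_polyFun {f : Matrix ι ι ℚ → ℚ} (hf : f ∈ polyFun ι) (h : Matrix ι ι ℚ) :
    (fun M => f (M * h)) ∈ polyFun ι := by
  induction hf using Algebra.adjoin_induction with
  | mem f hf =>
    obtain ⟨q, rfl⟩ := hf
    exact sum_mem_polyFun fun j _ => mul_mem_polyFun (entry_mem_polyFun _ _) (const_mem_polyFun _)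
  | algebraMap r => exact const_mem_polyFun r
  | add f g _ _ hf hg => exact add_mem_polyFun hf hg
  | mul f g _ _ hf hg => exact mul_mem_polyFun hf hg

omit [Fintype ι] [DecidableEq ι] in
lemma exists_polynomial_eval {f : Matrix ι ι ℚ → ℚ} (hf : f ∈ polyFun ι) (M N : Matrix ι ι ℚ) :
    ∃ P : Polynomial ℚ, ∀ t : ℚ, f (M + t • N) = P.eval t := by
  induction hf using Algebra.adjoin_induction with
  | mem f hf =>
    obtain ⟨q, rfl⟩ := hf
    exact ⟨Polynomial.C (M q.1 q.2) + Polynomial.X * Polynomial.C (N q.1 q.2), fun t => by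
      simp; ring⟩
  | algebraMap r => exact ⟨Polynomial.C r, fun t => by simp⟩
  | add f g _ _ hf hg =>
    obtain ⟨P, hP⟩ := hf
    obtain ⟨Q, hQ⟩ := hg
    exact ⟨P + Q, fun t => by simp [hP, hQ]⟩
  | mul f g _ _ hf hg =>
    obtain ⟨P, hP⟩ := hf
    obtain ⟨Q, hQ⟩ := hg
    exact ⟨P * Q, fun t => by simp [hP, hQ]⟩

/-- The coordinate ring of `SL(n)` over `ℚ` is a domain. -/
lemma exists_mul_ne_zero {f g : Matrix ι ι ℚ → ℚ} (hf : f ∈ polyFun ι) (hg : g ∈ polyFun ι)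
    {M₁ M₂ : SpecialLinearGroup ι ℚ} (h₁ : f M₁ ≠ 0) (h₂ : g M₂ ≠ 0) :
    ∃ M : SpecialLinearGroup ι ℚ, f M * g M ≠ 0 := by
  by_contra! hfg
  let H : Subgroup (SpecialLinearGroup ι ℚ) :=
    { carrier := {h | ∀ f ∈ polyFun ι, ∀ g ∈ polyFun ι,
        (∀ M : SpecialLinearGroup ι ℚ, f M * g M = 0) →
        ∀ M : SpecialLinearGroup ι ℚ, f M * g (M * h : SpecialLinearGroup ι ℚ) = 0}
      one_mem' := fun f _ g _ h M => by rw [mul_one]; exact h M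
      mul_mem' := by
        intro h k hh hk f hf g hg hfg M
        have h1 : ∀ M : SpecialLinearGroup ι ℚ,
            f M * g (M * k : SpecialLinearGroup ι ℚ) = 0 := hk f hf g hg hfg
        have h2 := hh f hf _ (mul_right_mem_polyFun hg k) h1 M
        rw [← mul_assoc]
        exact h2
      inv_mem' := by
        intro h hh f hf g hg hfg M
        have h1 := hh g hg f hf (fun M => by rw [mul_comm]; exact hfg M) (M * h⁻¹)
        rw [inv_mul_cancel_right] at h1
        rw [mul_comm]; exact h1 }
  have hH : HasElementary H := by
    intro i j hij t
    have hs : ∀ s : ℚ, ∃ τ : SpecialLinearGroup ι ℚ,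
        (τ : Matrix ι ι ℚ) = 1 + s • vecMulVec (Pi.single i 1) (Pi.single j 1) := by
      intro s
      obtain ⟨τ, -, hτ⟩ := hasTransvection_top (R := ℚ) (x := Pi.single i 1) (ψ := Pi.single j s)
        (by simp [hij])
      refine ⟨τ, ?_⟩
      rw [hτ, ← vecMulVec_smul, ← Pi.single_smul]; simp
    obtain ⟨τ, hτ⟩ := hs t
    refine ⟨τ, ?_, by rw [hτ, ← vecMulVec_smul, ← Pi.single_smul]; simp⟩
    intro f hf g hg hfg M
    obtain ⟨P, hP⟩ := exists_polynomial_eval hf (M : Matrix ι ι ℚ)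
      ((M : Matrix ι ι ℚ) * vecMulVec (Pi.single i 1) (Pi.single j 1))
    obtain ⟨Q, hQ⟩ := exists_polynomial_eval hg (M : Matrix ι ι ℚ)
      ((M : Matrix ι ι ℚ) * vecMulVec (Pi.single i 1) (Pi.single j 1))
    have hPQ : P * Q = 0 := by
      refine Polynomial.funext fun s => ?_
      obtain ⟨σ, hσ⟩ := hs s
      have := hfg (M * σ)
      rw [Matrix.SpecialLinearGroup.coe_mul, hσ, mul_add, mul_one, mul_smul_comm, hP, hQ] at this
      simpa using this
    rw [Matrix.SpecialLinearGroup.coe_mul, hτ, mul_add, mul_one, mul_smul_comm, hQ]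
    rcases mul_eq_zero.1 hPQ with h0 | h0
    · have := hP 0
      rw [h0, zero_smul, add_zero] at this
      rw [this]; simp
    · rw [h0]; simp
  have hmem : M₁⁻¹ * M₂ ∈ H := by rw [hH.eq_top]; trivial
  have := hmem f hf g hg hfg M₁
  rw [mul_inv_cancel_left] at this
  exact (mul_ne_zero h₁ h₂) this

end Generic

section GenericElements

variable {ι : Type*} [Fintype ι] [DecidableEq ι]

/-- A function on `SL(n, ℤ)` which is the restriction of a polynomial function that does not
vanish identically on `SL(n, ℚ)`. -/
def IsGeneric (f : SpecialLinearGroup ι ℤ → ℤ) : Prop :=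
  ∃ p ∈ polyFun ι,
    (∀ γ : SpecialLinearGroup ι ℤ, p ((γ : Matrix ι ι ℤ).map (Int.castRingHom ℚ)) = f γ) ∧
    ∃ M : SpecialLinearGroup ι ℚ, p (M : Matrix ι ι ℚ) ≠ 0

lemma IsGeneric.mul {f g : SpecialLinearGroup ι ℤ → ℤ} (hf : IsGeneric f) (hg : IsGeneric g) :
    IsGeneric fun γ => f γ * g γ := by
  obtain ⟨p, hp, hpf, M₁, h₁⟩ := hf
  obtain ⟨q, hq, hqg, M₂, h₂⟩ := hg
  exact ⟨_, mul_mem_polyFun hp hq, fun γ => by rw [hpf, hqg]; push_cast; rfl,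
    exists_mul_ne_zero hp hq h₁ h₂⟩

/-- Every generic function is nonzero somewhere on `Γ`. -/
def MeetsGeneric (Γ : Subgroup (SpecialLinearGroup ι ℤ)) : Prop :=
  ∀ f : SpecialLinearGroup ι ℤ → ℤ, IsGeneric f → ∃ γ ∈ Γ, f γ ≠ 0

omit [DecidableEq ι] in
lemma cast_dotProduct (x y : ι → ℤ) :
    ((x ⬝ᵥ y : ℤ) : ℚ) = (fun i => (x i : ℚ)) ⬝ᵥ fun i => (y i : ℚ) := by
  simp [dotProduct]

omit [DecidableEq ι] in
lemma cast_mulVec (M : Matrix ι ι ℤ) (x : ι → ℤ) :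
    (fun i => (((M *ᵥ x) i : ℤ) : ℚ)) = M.map (Int.castRingHom ℚ) *ᵥ fun i => (x i : ℚ) := by
  ext i
  simp [mulVec, dotProduct]

lemma cast_mulVec_inv (γ : SpecialLinearGroup ι ℤ) (x : ι → ℤ) :
    (fun i => (((((γ⁻¹ : SpecialLinearGroup ι ℤ) : Matrix ι ι ℤ) *ᵥ x) i : ℤ) : ℚ)) =
      ((γ : Matrix ι ι ℤ).map (Int.castRingHom ℚ)).adjugate *ᵥ fun i => (x i : ℚ) := by
  rw [cast_mulVec, Matrix.SpecialLinearGroup.coe_inv]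
  congr 1
  exact RingHom.map_adjugate (Int.castRingHom ℚ) (γ : Matrix ι ι ℤ)

lemma adjugate_mulVec_of_mulVec_eq {M : SpecialLinearGroup ι ℚ} {x y : ι → ℚ}
    (h : (M : Matrix ι ι ℚ) *ᵥ x = y) : (M : Matrix ι ι ℚ).adjugate *ᵥ y = x := by
  rw [← h, ← Matrix.SpecialLinearGroup.coe_inv, inv_mulVec_mulVec]

omit [Fintype ι] [DecidableEq ι] in
lemma cast_ne_zero {x : ι → ℤ} (hx : x ≠ 0) : (fun i => (x i : ℚ)) ≠ 0 := by
  intro h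
  exact hx (funext fun i => by simpa using congr_fun h i)

omit [Fintype ι] [DecidableEq ι] in
lemma Indep.cast {x y : ι → ℤ} (h : Indep x y) :
    Indep (fun i => (x i : ℚ)) (fun i => (y i : ℚ)) := by
  obtain ⟨i, j, h⟩ := h
  refine ⟨i, j, ?_⟩
  dsimp only
  exact_mod_cast h

lemma exists_dotProduct_ne_zero {R : Type*} [Semiring R] {ℓ : ι → R} (h : ℓ ≠ 0) :
    ∃ z, ℓ ⬝ᵥ z ≠ 0 := by
  obtain ⟨i, hi⟩ := Function.ne_iff.1 h
  exact ⟨Pi.single i 1, by simpa using hi⟩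

lemma isGeneric_mulVec (h3 : 3 ≤ Fintype.card ι) {ℓ x : ι → ℤ} (hℓ : ℓ ≠ 0) (hx : x ≠ 0) :
    IsGeneric fun γ : SpecialLinearGroup ι ℤ => ℓ ⬝ᵥ (γ : Matrix ι ι ℤ) *ᵥ x := by
  refine ⟨fun M => (fun i => (ℓ i : ℚ)) ⬝ᵥ M *ᵥ fun i => (x i : ℚ),
    dotProduct_mem_polyFun _ fun i => mulVec_mem_polyFun entry_mem_polyFun
      (fun j => const_mem_polyFun (x j : ℚ)) i, fun γ => ?_, ?_⟩
  · rw [cast_dotProduct, cast_mulVec]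
  · obtain ⟨z, hz⟩ := exists_dotProduct_ne_zero (cast_ne_zero hℓ)
    obtain ⟨M, hM⟩ := exists_mulVec h3 (cast_ne_zero hx) (a' := z) (by rintro rfl; simp at hz)
    exact ⟨M, by dsimp only; rwa [hM]⟩

lemma isGeneric_inv_mulVec (h3 : 3 ≤ Fintype.card ι) {ℓ x : ι → ℤ} (hℓ : ℓ ≠ 0) (hx : x ≠ 0) :
    IsGeneric fun γ : SpecialLinearGroup ι ℤ =>
      ℓ ⬝ᵥ ((γ⁻¹ : SpecialLinearGroup ι ℤ) : Matrix ι ι ℤ) *ᵥ x := by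
  refine ⟨fun M => (fun i => (ℓ i : ℚ)) ⬝ᵥ M.adjugate *ᵥ fun i => (x i : ℚ),
    dotProduct_mem_polyFun _ fun i => mulVec_mem_polyFun adjugate_mem_polyFun
      (fun j => const_mem_polyFun (x j : ℚ)) i, fun γ => ?_, ?_⟩
  · rw [cast_dotProduct, cast_mulVec_inv]
  · obtain ⟨z, hz⟩ := exists_dotProduct_ne_zero (cast_ne_zero hℓ)
    obtain ⟨M, hM⟩ := exists_mulVec h3 (a := z) (by rintro rfl; simp at hz) (cast_ne_zero hx)
    exact ⟨M, by dsimp only; rwa [adjugate_mulVec_of_mulVec_eq hM]⟩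

lemma isGeneric_conj (h3 : 3 ≤ Fintype.card ι) {φ a : ι → ℤ} (hφ : φ ≠ 0) (ha : a ≠ 0)
    {Y : Matrix ι ι ℤ} (hY : IsNilpotent Y) (hY0 : Y ≠ 0) :
    IsGeneric fun γ : SpecialLinearGroup ι ℤ =>
      φ ⬝ᵥ ((γ⁻¹ : SpecialLinearGroup ι ℤ) : Matrix ι ι ℤ) *ᵥ (Y *ᵥ ((γ : Matrix ι ι ℤ) *ᵥ a)) := by
  have h₁ : ∀ i, (fun M : Matrix ι ι ℚ => (M *ᵥ fun i => (a i : ℚ)) i) ∈ polyFun ι := fun i =>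
    mulVec_mem_polyFun entry_mem_polyFun (fun j => const_mem_polyFun (a j : ℚ)) i
  have h₂ : ∀ i, (fun M : Matrix ι ι ℚ =>
      (Y.map (Int.castRingHom ℚ) *ᵥ (M *ᵥ fun i => (a i : ℚ))) i) ∈ polyFun ι := fun i =>
    mulVec_mem_polyFun (F := fun _ => Y.map (Int.castRingHom ℚ))
      (fun _ _ => const_mem_polyFun _) h₁ i
  refine ⟨fun M => (fun i => (φ i : ℚ)) ⬝ᵥ M.adjugate *ᵥ
      (Y.map (Int.castRingHom ℚ) *ᵥ (M *ᵥ fun i => (a i : ℚ))),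
    dotProduct_mem_polyFun _ fun i => mulVec_mem_polyFun adjugate_mem_polyFun h₂ i,
    fun γ => ?_, ?_⟩
  · rw [cast_dotProduct, cast_mulVec_inv, cast_mulVec, cast_mulVec]
  · obtain ⟨z, hz⟩ : ∃ z : ι → ℚ, Y.map (Int.castRingHom ℚ) *ᵥ z ≠ 0 := by
      by_contra! h
      refine hY0 (Matrix.ext fun i j => ?_)
      have := congr_fun (h (Pi.single j 1)) i
      rw [mulVec_single_one] at this
      simpa using this
    have hz0 : z ≠ 0 := by rintro rfl; simp at hz
    have hind : Indep z (Y.map (Int.castRingHom ℚ) *ᵥ z) := by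
      by_contra h
      simp only [Indep, not_exists, not_not] at h
      obtain ⟨i, hi⟩ := Function.ne_iff.1 hz0
      set c := (Y.map (Int.castRingHom ℚ) *ᵥ z) i / z i with hc
      have hYz : Y.map (Int.castRingHom ℚ) *ᵥ z = c • z := by
        ext j
        have := h i j
        simp only [Pi.zero_apply] at hi
        rw [Pi.smul_apply, smul_eq_mul, hc]
        field_simp
        linear_combination this
      have hpow : ∀ k : ℕ, (Y.map (Int.castRingHom ℚ)) ^ k *ᵥ z = c ^ k • z := by
        intro k
        induction k with
        | zero => simp
        | succ k ih => rw [pow_succ, ← mulVec_mulVec, hYz, mulVec_smul, ih, smul_smul, pow_succ']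
      obtain ⟨k, hk⟩ := hY
      have h1 := hpow k
      have h2 : (Y.map (Int.castRingHom ℚ)) ^ k = 0 := by
        have := map_pow (Int.castRingHom ℚ).mapMatrix Y k
        rw [hk, map_zero] at this
        exact this.symm
      rw [h2, zero_mulVec] at h1
      have hc0 : c = 0 := by
        rcases smul_eq_zero.1 h1.symm with h | h
        · exact (pow_eq_zero_iff (fun h0 => by simp [h0] at h)).1 h
        · exact absurd h hz0
      rw [hc0, zero_smul] at hYz
      exact hz hYz
    obtain ⟨c, hc⟩ : ∃ c : ι → ℚ, Indep (fun i => (a i : ℚ)) c ∧ (fun i => (φ i : ℚ)) ⬝ᵥ c ≠ 0 := by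
      obtain ⟨d, hd⟩ := exists_dotProduct_ne_zero (cast_ne_zero hφ)
      by_cases h : Indep (fun i => (a i : ℚ)) d
      · exact ⟨d, h, hd⟩
      obtain ⟨e, he⟩ := exists_indep h3 (cast_ne_zero ha)
      by_cases h' : (fun i => (φ i : ℚ)) ⬝ᵥ e = 0
      · refine ⟨d + e, ?_, by rwa [dotProduct_add, h', add_zero]⟩
        obtain ⟨i, j, hij⟩ := he
        simp only [Indep, not_exists, not_not] at h
        refine ⟨i, j, fun e' => hij ?_⟩
        have := h i j
        simp only [Pi.add_apply] at e'
        linear_combination e' - this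
      · exact ⟨e, he, h'⟩
    obtain ⟨M, hM, hM'⟩ := exists_mulVec_pair h3 hc.1 hind
    exact ⟨M, by dsimp only; rw [hM, adjugate_mulVec_of_mulVec_eq hM']; exact hc.2⟩

lemma isGeneric_minor (h3 : 3 ≤ Fintype.card ι) {χ₁ χ₂ a ℓ : ι → ℤ} (hχ : Indep χ₁ χ₂)
    (ha : Indep a ℓ) :
    IsGeneric fun γ : SpecialLinearGroup ι ℤ =>
      (χ₁ ⬝ᵥ (γ : Matrix ι ι ℤ) *ᵥ a) * (χ₂ ⬝ᵥ (γ : Matrix ι ι ℤ) *ᵥ ℓ) -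
      (χ₂ ⬝ᵥ (γ : Matrix ι ι ℤ) *ᵥ a) * (χ₁ ⬝ᵥ (γ : Matrix ι ι ℤ) *ᵥ ℓ) := by
  have hp : ∀ η x : ι → ℤ, (fun M : Matrix ι ι ℚ =>
      (fun i => (η i : ℚ)) ⬝ᵥ M *ᵥ fun i => (x i : ℚ)) ∈
      polyFun ι := fun η x => dotProduct_mem_polyFun _ fun i => mulVec_mem_polyFun entry_mem_polyFun
      (fun j => const_mem_polyFun (x j : ℚ)) i
  refine ⟨_, sub_mem_polyFun (mul_mem_polyFun (hp χ₁ a) (hp χ₂ ℓ))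
    (mul_mem_polyFun (hp χ₂ a) (hp χ₁ ℓ)), fun γ => ?_, ?_⟩
  · push_cast
    simp only [cast_dotProduct, cast_mulVec]
  · obtain ⟨z, hz, hz'⟩ := hχ.cast.exists_dotProduct
    obtain ⟨w, hw, hw'⟩ := hχ.symm.cast.exists_dotProduct
    have hzw : Indep z w := indep_of_dotProduct (by rintro rfl; simp at hz') hz hw'
    obtain ⟨M, hM, hM'⟩ := exists_mulVec_pair h3 ha.cast hzw
    refine ⟨M, ?_⟩
    rw [hM, hM', hz, zero_mul, zero_sub, neg_ne_zero]
    exact mul_ne_zero hz' hw'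

lemma isGeneric_ratio (h3 : 3 ≤ Fintype.card ι) {φ χ a c : ι → ℤ} (hφ : Indep φ χ) (ha : a ≠ 0)
    (A : ℤ) {B : ℤ} (hB : B ≠ 0) (hφa : φ ⬝ᵥ a = 0)
    (hχa : χ ⬝ᵥ a = 0) :
    IsGeneric fun γ : SpecialLinearGroup ι ℤ =>
      A * ((φ ⬝ᵥ (γ : Matrix ι ι ℤ) *ᵥ a) *
        (φ ⬝ᵥ ((γ⁻¹ : SpecialLinearGroup ι ℤ) : Matrix ι ι ℤ) *ᵥ c)) -
      B * ((φ ⬝ᵥ ((γ⁻¹ : SpecialLinearGroup ι ℤ) : Matrix ι ι ℤ) *ᵥ a) *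
        (χ ⬝ᵥ (γ : Matrix ι ι ℤ) *ᵥ a)) := by
  have hp : ∀ η x : ι → ℤ, (fun M : Matrix ι ι ℚ =>
      (fun i => (η i : ℚ)) ⬝ᵥ M *ᵥ fun i => (x i : ℚ)) ∈
      polyFun ι := fun η x => dotProduct_mem_polyFun _ fun i => mulVec_mem_polyFun entry_mem_polyFun
      (fun j => const_mem_polyFun (x j : ℚ)) i
  have hp' : ∀ η x : ι → ℤ, (fun M : Matrix ι ι ℚ =>
      (fun i => (η i : ℚ)) ⬝ᵥ M.adjugate *ᵥ fun i => (x i : ℚ)) ∈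
      polyFun ι := fun η x => dotProduct_mem_polyFun _ fun i =>
        mulVec_mem_polyFun adjugate_mem_polyFun (fun j => const_mem_polyFun (x j : ℚ)) i
  refine ⟨_, sub_mem_polyFun (mul_mem_polyFun (const_mem_polyFun (A : ℚ))
      (mul_mem_polyFun (hp φ a) (hp' φ c)))
    (mul_mem_polyFun (const_mem_polyFun (B : ℚ)) (mul_mem_polyFun (hp' φ a) (hp χ a))),
    fun γ => ?_, ?_⟩
  · push_cast
    simp only [cast_dotProduct, cast_mulVec_inv]
    simp only [cast_mulVec]
  · obtain ⟨z, hz, hz'⟩ := hφ.cast.exists_dotProduct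
    have hz0 : z ≠ 0 := by rintro rfl; simp at hz'
    have hφ0 : φ ≠ 0 := by
      rintro rfl
      obtain ⟨i, j, h⟩ := hφ
      simp at h
    obtain ⟨d, hd⟩ := exists_dotProduct_ne_zero (cast_ne_zero hφ0)
    have had : Indep (fun i => (a i : ℚ)) d :=
      indep_of_dotProduct (cast_ne_zero ha) (by rw [← cast_dotProduct, hφa, Int.cast_zero]) hd
    have haz : Indep (fun i => (a i : ℚ)) z :=
      indep_of_dotProduct (cast_ne_zero ha) (by rw [← cast_dotProduct, hχa, Int.cast_zero]) hz'
    obtain ⟨M, hM, hM'⟩ := exists_mulVec_pair h3 had haz.symm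
    refine ⟨M, ?_⟩
    rw [hM, adjugate_mulVec_of_mulVec_eq hM', hz, zero_mul, mul_zero, zero_sub, neg_ne_zero]
    exact mul_ne_zero (Int.cast_ne_zero.2 hB) (mul_ne_zero hd hz')

end GenericElements

section Span

variable {ι : Type*}

lemma exists_smul_eq_of_mem_span {H : AddSubgroup (ι → ℤ)} {w : ι → ℚ}
    (hw : w ∈ Submodule.span ℚ ((fun (x : ι → ℤ) i => (x i : ℚ)) '' H)) :
    ∃ k : ℤ, k ≠ 0 ∧ ∃ χ ∈ H, ∀ i, (k : ℚ) * w i = χ i := by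
  induction hw using Submodule.span_induction with
  | mem w hw =>
    obtain ⟨x, hx, rfl⟩ := hw
    exact ⟨1, one_ne_zero, x, hx, by simp⟩
  | zero => exact ⟨1, one_ne_zero, 0, H.zero_mem, by simp⟩
  | add x y _ _ hx hy =>
    obtain ⟨k, hk, χ, hχ, e⟩ := hx
    obtain ⟨l, hl, η, hη, e'⟩ := hy
    refine ⟨k * l, mul_ne_zero hk hl, l • χ + k • η,
      H.add_mem (H.zsmul_mem hχ l) (H.zsmul_mem hη k), fun i => ?_⟩
    simp only [Pi.add_apply, Pi.smul_apply, smul_eq_mul, Int.cast_mul, Int.cast_add]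
    rw [← e, ← e']
    ring
  | smul r x _ hx =>
    obtain ⟨k, hk, χ, hχ, e⟩ := hx
    refine ⟨r.den * k, mul_ne_zero (by exact_mod_cast r.den_ne_zero) hk, r.num • χ,
      H.zsmul_mem hχ _, fun i => ?_⟩
    simp only [Pi.smul_apply, smul_eq_mul, Int.cast_mul, Int.cast_natCast]
    rw [← e]
    linear_combination (k : ℚ) * x i * r.den_mul_eq_num

variable [Fintype ι] [DecidableEq ι]

/-- Integral vectors are separated from a rational span by an integral functional. -/
lemma exists_dotProduct_of_notMem_span {S : Set (ι → ℤ)} {w : ι → ℚ}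
    (hw : w ∉ Submodule.span ℚ ((fun (x : ι → ℤ) i => (x i : ℚ)) '' S)) :
    ∃ ℓ : ι → ℤ, (∀ x ∈ S, ℓ ⬝ᵥ x = 0) ∧ (fun i => (ℓ i : ℚ)) ⬝ᵥ w ≠ 0 := by
  obtain ⟨f, hf, hS⟩ := Submodule.exists_le_ker_of_notMem hw
  obtain ⟨b, hb⟩ := IsLocalization.exist_integer_multiples_of_finite (nonZeroDivisors ℤ)
    fun i => f (Pi.single i 1)
  choose ℓ hℓ using hb
  have hb0 : ((b : ℤ) : ℚ) ≠ 0 := by exact_mod_cast nonZeroDivisors.coe_ne_zero b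
  have hfx : ∀ x : ι → ℚ, (fun i => (ℓ i : ℚ)) ⬝ᵥ x = (b : ℤ) * f x := by
    intro x
    conv_rhs => rw [← Finset.univ_sum_single x, map_sum, Finset.mul_sum]
    refine Finset.sum_congr rfl fun i _ => ?_
    have h1 : (ℓ i : ℚ) = (b : ℤ) * f (Pi.single i 1) := by
      have := hℓ i
      simp only [zsmul_eq_mul, algebraMap_int_eq, eq_intCast] at this
      exact this
    have h2 : f (Pi.single i (x i)) = x i * f (Pi.single i 1) := by
      rw [← smul_eq_mul, ← map_smul, ← Pi.single_smul, smul_eq_mul, mul_one]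
    simp only [h1, h2]
    ring
  refine ⟨ℓ, fun x hx => ?_, by rw [hfx]; exact mul_ne_zero hb0 hf⟩
  have h1 : f (fun i => (x i : ℚ)) = 0 := hS (Submodule.subset_span ⟨x, hx, rfl⟩)
  have h2 := hfx fun i => (x i : ℚ)
  rw [h1, mul_zero, ← cast_dotProduct] at h2
  exact_mod_cast h2

end Span

section Saturation

variable {ι : Type*} [Fintype ι] [DecidableEq ι] {Γ : Subgroup (SpecialLinearGroup ι ℤ)}
  {a : ι → ℤ}

lemma HasTransvection.conj_iff {x ψ : ι → ℤ} {γ : SpecialLinearGroup ι ℤ} (hγ : γ ∈ Γ) :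
    HasTransvection Γ ((γ : Matrix ι ι ℤ) *ᵥ x) ψ ↔
      HasTransvection Γ x (ψ ᵥ* (γ : Matrix ι ι ℤ)) := by
  constructor
  · intro h
    have := h.conj (inv_mem hγ)
    rwa [inv_mulVec_mulVec, inv_inv] at this
  · intro h
    have := h.conj hγ
    rwa [vecMul_vecMul, ← Matrix.SpecialLinearGroup.coe_mul, mul_inv_cancel,
      Matrix.SpecialLinearGroup.coe_one, vecMul_one] at this

/-- `Γ` has two independent transvections with the same image. -/
def HasTransvectionPair (Γ : Subgroup (SpecialLinearGroup ι ℤ)) (a : ι → ℤ) : Prop :=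
  a ≠ 0 ∧ ∃ χ₁ χ₂, Indep χ₁ χ₂ ∧ HasTransvection Γ a χ₁ ∧ HasTransvection Γ a χ₂

lemma HasTransvectionPair.not_indep (h : HasTransvectionPair Γ a) (hΓ : MeetsGeneric Γ)
    (h3 : 3 ≤ Fintype.card ι) {ℓ : ι → ℤ} (hℓ : ∀ χ ∈ covectors Γ a, χ ⬝ᵥ ℓ = 0) :
    ¬ Indep a ℓ := by
  intro hind
  obtain ⟨ha, χ₁, χ₂, hχ, h₁, h₂⟩ := h
  have hχ₁ : χ₁ ≠ 0 := by
    rintro rfl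
    obtain ⟨i, j, h⟩ := hχ
    simp at h
  obtain ⟨γ, hγ, hne⟩ := hΓ _ ((isGeneric_minor h3 hχ hind).mul (isGeneric_inv_mulVec h3 hχ₁ ha))
  obtain ⟨hne₁, hne₂⟩ := mul_ne_zero_iff.1 hne
  set b := (γ : Matrix ι ι ℤ) *ᵥ a with hb
  set χ := (χ₁ ⬝ᵥ b) • χ₂ - (χ₂ ⬝ᵥ b) • χ₁ with hχdef
  have hχa : HasTransvection Γ a χ :=
    (covectors Γ a).sub_mem (h₂.smul_right _) (h₁.smul_right _)
  have hχb : χ ⬝ᵥ b = 0 := by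
    rw [hχdef, sub_dotProduct, smul_dotProduct, smul_dotProduct, smul_eq_mul, smul_eq_mul]
    ring
  have hT := (h₁.conj hγ).comm hχa hχb
  rw [← hb, ← dotProduct_mulVec, hb, HasTransvection.conj_iff hγ] at hT
  have h0 := hℓ _ hT
  rw [← dotProduct_mulVec, smul_dotProduct, smul_eq_mul] at h0
  refine mul_ne_zero hne₂ ?_ h0
  rw [hχdef, sub_dotProduct, smul_dotProduct, smul_dotProduct, smul_eq_mul, smul_eq_mul]
  exact hne₁

/-- All covectors vanishing on `a` define transvections in `Γ`, up to multiples. -/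
def IsSaturated (Γ : Subgroup (SpecialLinearGroup ι ℤ)) (a : ι → ℤ) : Prop :=
  ∀ ψ : ι → ℤ, ψ ⬝ᵥ a = 0 → ∃ k : ℤ, k ≠ 0 ∧ HasTransvection Γ a (k • ψ)

lemma HasTransvectionPair.isSaturated (h : HasTransvectionPair Γ a) (hΓ : MeetsGeneric Γ)
    (h3 : 3 ≤ Fintype.card ι) : IsSaturated Γ a := by
  intro ψ hψ
  by_cases hw : (fun i => (ψ i : ℚ)) ∈
      Submodule.span ℚ ((fun (x : ι → ℤ) i => (x i : ℚ)) '' (covectors Γ a))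
  · obtain ⟨k, hk, χ, hχ, e⟩ := exists_smul_eq_of_mem_span hw
    refine ⟨k, hk, ?_⟩
    convert mem_covectors.1 hχ using 1
    ext i
    have := e i
    simp only [Pi.smul_apply, smul_eq_mul]
    exact_mod_cast this
  · obtain ⟨ℓ, hℓ, hne⟩ := exists_dotProduct_of_notMem_span hw
    rw [← cast_dotProduct, dotProduct_comm] at hne
    refine absurd (indep_of_dotProduct h.1 hψ (by exact_mod_cast hne)) ?_
    exact h.not_indep hΓ h3 fun χ hχ => by rw [dotProduct_comm]; exact hℓ χ hχ

lemma IsSaturated.mulVec (h : IsSaturated Γ a) {γ : SpecialLinearGroup ι ℤ} (hγ : γ ∈ Γ) :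
    IsSaturated Γ ((γ : Matrix ι ι ℤ) *ᵥ a) := by
  intro ψ hψ
  rw [dotProduct_mulVec] at hψ
  obtain ⟨k, hk, h⟩ := h _ hψ
  exact ⟨k, hk, by rwa [HasTransvection.conj_iff hγ, smul_vecMul]⟩

lemma exists_det_ne_zero (hΓ : MeetsGeneric Γ) (h3 : 3 ≤ Fintype.card ι) (ha : a ≠ 0) :
    ∃ γ : ι → SpecialLinearGroup ι ℤ, (∀ j, γ j ∈ Γ) ∧
      (Matrix.of fun i j => ((γ j : Matrix ι ι ℤ) *ᵥ a) i).det ≠ 0 := by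
  set S : Set (ι → ℤ) := {x | ∃ γ ∈ Γ, (γ : Matrix ι ι ℤ) *ᵥ a = x} with hS
  have hspan : ⊤ ≤ Submodule.span ℚ ((fun (x : ι → ℤ) i => (x i : ℚ)) '' S) := by
    intro w _
    by_contra hw
    obtain ⟨ℓ, hℓ, hne⟩ := exists_dotProduct_of_notMem_span hw
    have hℓ0 : ℓ ≠ 0 := by rintro rfl; simp [dotProduct] at hne
    obtain ⟨γ, hγ, h⟩ := hΓ _ (isGeneric_mulVec h3 hℓ0 ha)
    exact h (hℓ _ ⟨γ, hγ, rfl⟩)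
  set b := Module.Basis.ofSpan hspan
  let e := b.indexEquiv (Pi.basisFun ℚ ι)
  have hb : ∀ j, ∃ γ ∈ Γ, (fun i => ((((γ : SpecialLinearGroup ι ℤ) : Matrix ι ι ℤ) *ᵥ a) i : ℚ)) =
      (b.reindex e) j := by
    intro j
    obtain ⟨x, ⟨γ, hγ, rfl⟩, hx⟩ := Module.Basis.ofSpan_subset hspan ⟨e.symm j, rfl⟩
    exact ⟨γ, hγ, by rw [Module.Basis.reindex_apply]; exact hx⟩
  choose γ hγ hb using hb
  refine ⟨γ, hγ, fun h0 => ?_⟩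
  set A : Matrix ι ι ℤ := Matrix.of fun i j => ((γ j : Matrix ι ι ℤ) *ᵥ a) i with hA
  have hli : LinearIndependent ℚ (A.map (Int.castRingHom ℚ)).col := by
    have : (A.map (Int.castRingHom ℚ)).col = b.reindex e := by
      ext j i
      rw [← hb j]
      simp [hA]
    rw [this]
    exact (b.reindex e).linearIndependent
  rw [linearIndependent_cols_iff_isUnit, isUnit_iff_isUnit_det] at hli
  refine hli.ne_zero ?_
  have := RingHom.map_det (Int.castRingHom ℚ) A
  rw [h0, map_zero] at this
  exact this.symm

end Saturation

section FiniteIndex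

variable {ι : Type*} [Fintype ι] [DecidableEq ι] {Γ : Subgroup (SpecialLinearGroup ι ℤ)}
  {A : Matrix ι ι ℤ}

/-- The matrices `h` in `SL(n, ℤ)` such that `A h A⁻¹` belongs to `Γ`. -/
def pullback (Γ : Subgroup (SpecialLinearGroup ι ℤ)) (A : Matrix ι ι ℤ) :
    Subgroup (SpecialLinearGroup ι ℤ) where
  carrier := {h | ∃ g ∈ Γ, (g : Matrix ι ι ℤ) * A = A * h}
  one_mem' := ⟨1, one_mem _, by simp⟩
  mul_mem' := by
    rintro h k ⟨g, hg, e⟩ ⟨g', hg', e'⟩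
    refine ⟨g * g', mul_mem hg hg', ?_⟩
    rw [Matrix.SpecialLinearGroup.coe_mul, Matrix.SpecialLinearGroup.coe_mul, mul_assoc, e',
      ← mul_assoc, e, mul_assoc]
  inv_mem' := by
    rintro h ⟨g, hg, e⟩
    refine ⟨g⁻¹, inv_mem hg, ?_⟩
    calc ((g⁻¹ : SpecialLinearGroup ι ℤ) : Matrix ι ι ℤ) * A
        = (g⁻¹ : SpecialLinearGroup ι ℤ) *
          (A * (h * (h⁻¹ : SpecialLinearGroup ι ℤ) : SpecialLinearGroup ι ℤ)) := by
          rw [mul_inv_cancel, Matrix.SpecialLinearGroup.coe_one, mul_one]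
      _ = ((g⁻¹ * g : SpecialLinearGroup ι ℤ) : Matrix ι ι ℤ) *
          (A * (h⁻¹ : SpecialLinearGroup ι ℤ)) := by
          rw [Matrix.SpecialLinearGroup.coe_mul, ← mul_assoc A, ← e,
            Matrix.SpecialLinearGroup.coe_mul]
          simp only [mul_assoc]
      _ = _ := by rw [inv_mul_cancel, Matrix.SpecialLinearGroup.coe_one, one_mul]

lemma mul_left_cancel_of_det {R : Type*} [CommRing R] [IsDomain R] {A M N : Matrix ι ι R}
    (hA : A.det ≠ 0) (h : A * M = A * N) : M = N := by
  have h1 : A.det • M = A.det • N := by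
    rw [← one_mul M, ← one_mul N, ← smul_mul_assoc, ← smul_mul_assoc, ← adjugate_mul, mul_assoc,
      h, mul_assoc]
  exact smul_right_injective _ hA h1

lemma finiteIndex_of_pullback (hA : A.det ≠ 0) (h : (pullback Γ A).FiniteIndex) :
    Γ.FiniteIndex := by
  set K := congruence ι A.det.natAbs with hK
  have : NeZero A.det.natAbs := ⟨by simpa using hA⟩
  have hex : ∀ x : K, ∃ h : SpecialLinearGroup ι ℤ,
      A * (h : Matrix ι ι ℤ) = (x : SpecialLinearGroup ι ℤ) * A := by
    rintro ⟨x, hx⟩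
    obtain ⟨M, hM⟩ := mem_congruence.1 hx
    obtain ⟨c, hc⟩ := Int.dvd_natAbs_self (a := A.det)
    have e : A * (1 + A.adjugate * (c • M) * A) = x * A := by
      rw [hM, hc, mul_add, ← mul_assoc, ← mul_assoc, mul_adjugate, add_mul]
      simp [mul_assoc]
    refine ⟨⟨1 + A.adjugate * (c • M) * A, ?_⟩, e⟩
    have := congr_arg det e
    rw [det_mul, det_mul, x.det_coe, one_mul] at this
    exact mul_left_cancel₀ hA (this.trans (mul_one _).symm)
  choose θ hθ using hex
  let Θ : K →* SpecialLinearGroup ι ℤ := MonoidHom.mk' θ fun x y => by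
    refine Subtype.ext (mul_left_cancel_of_det hA ?_)
    rw [hθ, Matrix.SpecialLinearGroup.coe_mul, ← mul_assoc, hθ, mul_assoc, hθ, ← mul_assoc,
      Subgroup.coe_mul, Matrix.SpecialLinearGroup.coe_mul]
  have hle : ((pullback Γ A).comap Θ).map K.subtype ≤ Γ := by
    rintro _ ⟨x, ⟨g, hg, e⟩, rfl⟩
    have e' : (g : Matrix ι ι ℤ) * A = (x : SpecialLinearGroup ι ℤ) * A := e.trans (hθ x)
    have : g = x := by
      refine Subtype.ext (transpose_injective (mul_left_cancel_of_det (A := Aᵀ)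
        (by rwa [det_transpose]) ?_))
      rw [← transpose_mul, ← transpose_mul, e']
    rw [Subgroup.coe_subtype, ← this]
    exact hg
  have hK : K.FiniteIndex := inferInstance
  have : (((pullback Γ A).comap Θ).map K.subtype).FiniteIndex := by
    refine ⟨?_⟩
    rw [Subgroup.index_map_subtype]
    exact mul_ne_zero (by rw [Subgroup.index_comap]; exact Subgroup.FiniteIndex.index_ne_zero)
      hK.index_ne_zero
  exact Subgroup.finiteIndex_of_le hle

theorem HasTransvectionPair.finiteIndex {a : ι → ℤ} (h : HasTransvectionPair Γ a)
    (hΓ : MeetsGeneric Γ) (h3 : 3 ≤ Fintype.card ι) (h3' : ∀ i j : ι, ∃ k, k ≠ i ∧ k ≠ j) :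
    Γ.FiniteIndex := by
  obtain ⟨γ, hγ, hA⟩ := exists_det_ne_zero hΓ h3 h.1
  set A : Matrix ι ι ℤ := Matrix.of fun i j => ((γ j : Matrix ι ι ℤ) *ᵥ a) i with hAdef
  have hAe : ∀ i, A *ᵥ Pi.single i 1 = (γ i : Matrix ι ι ℤ) *ᵥ a := fun i => by
    ext; simp [hAdef]
  have hsat : ∀ p : ι × ι, ∃ k : ℤ, k ≠ 0 ∧ (p.1 ≠ p.2 →
      HasTransvection Γ (A *ᵥ Pi.single p.1 1) (k • (Pi.single p.2 1 ᵥ* A.adjugate))) := by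
    rintro ⟨i, j⟩
    by_cases hij : i = j
    · exact ⟨1, one_ne_zero, fun h => absurd hij h⟩
    obtain ⟨k, hk, hT⟩ := (h.isSaturated hΓ h3).mulVec (hγ i) (Pi.single j 1 ᵥ* A.adjugate) (by
      rw [← hAe, dotProduct_mulVec, vecMul_vecMul, adjugate_mul]
      simp [hij])
    exact ⟨k, hk, fun _ => by rw [hAe]; exact hT⟩
  choose k hk hT using hsat
  set t := ∏ p, k p with ht
  have ht0 : t ≠ 0 := Finset.prod_ne_zero_iff.2 fun p _ => hk p
  refine finiteIndex_of_pullback hA (HasElementaryLevel.finiteIndex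
    (q := 2 * (t * A.det).natAbs ^ 2) ?_ ?_ h3')
  · intro i j hij
    obtain ⟨x, -, hx⟩ := hasTransvection_top (R := ℤ) (x := Pi.single i 1)
      (ψ := Pi.single j ((2 * (t * A.det).natAbs ^ 2 : ℕ) : ℤ)) (by simp [hij])
    obtain ⟨c, hc⟩ := Finset.dvd_prod_of_mem k (Finset.mem_univ (i, j))
    obtain ⟨g, hg, e⟩ := (hT (i, j) hij).smul_right (2 * t * A.det * c)
    refine ⟨x, ⟨g, hg, ?_⟩, hx⟩
    rw [hx, e, add_mul, mul_add, one_mul, mul_one, vecMulVec_mul, mul_vecMulVec, smul_smul,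
      smul_vecMul, vecMul_vecMul, adjugate_mul]
    congr 2
    have h1 : (2 * t * A.det * c * k (i, j)) * A.det = ((2 * (t * A.det).natAbs ^ 2 : ℕ) : ℤ) := by
      push_cast
      rw [sq_abs]
      linear_combination -2 * t * A.det ^ 2 * hc
    rw [← h1, vecMul_smul, vecMul_one, smul_smul]
    ext l
    simp [Pi.single_apply]
  · have : 0 < (t * A.det).natAbs := Int.natAbs_pos.2 (mul_ne_zero ht0 hA)
    nlinarith

end FiniteIndex

section Pair

variable {ι : Type*} [Fintype ι] [DecidableEq ι] {Γ : Subgroup (SpecialLinearGroup ι ℤ)}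
  {a φ : ι → ℤ}

omit [Fintype ι] [DecidableEq ι] in
lemma Indep.smul_right {R : Type*} [CommRing R] [IsDomain R] {x y : ι → R} (h : Indep x y) {k : R}
    (hk : k ≠ 0) : Indep x (k • y) := by
  obtain ⟨i, j, h⟩ := h
  refine ⟨i, j, fun e => h (mul_left_cancel₀ hk ?_)⟩
  simp only [Pi.smul_apply, smul_eq_mul] at e
  linear_combination e

omit [Fintype ι] [DecidableEq ι] in
lemma Indep.smul_sub_smul {R : Type*} [CommRing R] [IsDomain R] {x y : ι → R} (h : Indep x y)
    (s : R) {t : R} (ht : t ≠ 0) : Indep x (s • x - t • y) := by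
  obtain ⟨i, j, h⟩ := h
  refine ⟨i, j, fun e => h (mul_left_cancel₀ ht ?_)⟩
  simp only [Pi.smul_apply, Pi.sub_apply, smul_eq_mul] at e
  linear_combination -e

omit [Fintype ι] [DecidableEq ι] in
lemma Indep.right_ne_zero {R : Type*} [CommRing R] {x y : ι → R} (h : Indep x y) : y ≠ 0 := by
  rintro rfl
  obtain ⟨i, j, h⟩ := h
  simp at h

omit [DecidableEq ι] in
lemma vecMulVec_mulVec_eq_smul {R : Type*} [CommSemiring R] (x ψ y : ι → R) :
    vecMulVec x ψ *ᵥ y = (ψ ⬝ᵥ y) • x := by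
  rw [vecMulVec_mulVec]
  ext; simp [mul_comm]

lemma HasTransvection.pair {x ψ y χ : ι → ℤ} (h : HasTransvection Γ x ψ)
    (h' : HasTransvection Γ y χ) (hx : x ≠ 0) (hχ : χ ≠ 0) (h0 : χ ⬝ᵥ x = 0) (h1 : ψ ⬝ᵥ y ≠ 0) :
    HasTransvectionPair Γ x := by
  refine ⟨hx, ψ, _, ?_, h, h.comm h' h0⟩
  refine (Indep.symm ?_ : Indep ψ χ).smul_right h1
  exact indep_of_dotProduct (φ := y) hχ (by rw [dotProduct_comm]; exact h'.dotProduct_eq)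
    (by rwa [dotProduct_comm])

lemma exists_polynomial_pow {N : Matrix ι ι ℤ} (hN : IsNilpotent N) (ψ b : ι → ℤ) :
    ∃ P : Polynomial ℚ, ∀ k : ℕ, ((ψ ⬝ᵥ (1 + N) ^ k *ᵥ b : ℤ) : ℚ) = P.eval (k : ℚ) := by
  obtain ⟨r, hr⟩ := hN
  refine ⟨∑ m ∈ Finset.range r, Polynomial.C (((ψ ⬝ᵥ N ^ m *ᵥ b : ℤ) : ℚ) / m.factorial) *
    descPochhammer ℚ m, fun k => ?_⟩
  have h1 : (1 + N) ^ k = ∑ m ∈ Finset.range r, (k.choose m : ℤ) • N ^ m := by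
    rw [add_comm, (Commute.one_right N).add_pow]
    have h2 : ∀ s, k + 1 ≤ s → ∑ m ∈ Finset.range (k + 1), N ^ m * 1 ^ (k - m) * k.choose m =
        ∑ m ∈ Finset.range s, (k.choose m : ℤ) • N ^ m := by
      intro s hs
      rw [← Finset.sum_subset (Finset.range_mono hs)]
      · refine Finset.sum_congr rfl fun m _ => ?_
        simp [Nat.cast_comm]
      · intro m _ hm
        rw [Nat.choose_eq_zero_of_lt (by simpa using hm)]
        simp
    rw [h2 (max (k + 1) r) (le_max_left _ _)]
    symm
    refine Finset.sum_subset (Finset.range_mono (le_max_right _ _)) fun m _ hm => ?_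
    rw [pow_eq_zero_of_le (by simpa using hm) hr, smul_zero]
  rw [h1, Polynomial.eval_finsetSum, sum_mulVec, dotProduct_sum, Int.cast_sum]
  refine Finset.sum_congr rfl fun m _ => ?_
  rw [Polynomial.eval_mul, Polynomial.eval_C, descPochhammer_eval_eq_descFactorial,
    Nat.descFactorial_eq_factorial_mul_choose, smul_mulVec, dotProduct_smul]
  have : (m.factorial : ℚ) ≠ 0 := by exact_mod_cast m.factorial_ne_zero
  push_cast
  field_simp
  simp [mul_comm]

lemma exists_pair_of_sq_ne_zero (hΓ : MeetsGeneric Γ) (h3 : 3 ≤ Fintype.card ι) (ha : a ≠ 0)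
    (hφ : φ ≠ 0) (hT : HasTransvection Γ a φ) {v : SpecialLinearGroup ι ℤ} (hv : v ∈ Γ)
    {N : Matrix ι ι ℤ} (hvN : (v : Matrix ι ι ℤ) = 1 + N) (hN : IsNilpotent N)
    (hNa : N *ᵥ a = 0) (hφN : φ ᵥ* N = 0) (hsq : N * N ≠ 0) :
    ∃ y, HasTransvectionPair Γ y := by
  set w : Matrix ι ι ℤ := ((v⁻¹ : SpecialLinearGroup ι ℤ) : Matrix ι ι ℤ) with hw
  have hwv : w * (1 + N) = 1 := by
    rw [← hvN, ← Matrix.SpecialLinearGroup.coe_mul, inv_mul_cancel,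
      Matrix.SpecialLinearGroup.coe_one]
  have hvw : (1 + N) * w = 1 := by
    rw [← hvN, ← Matrix.SpecialLinearGroup.coe_mul, mul_inv_cancel,
      Matrix.SpecialLinearGroup.coe_one]
  have hNw : Commute N w := by
    have h1 : N * w = 1 - w := by rw [← hvw, add_mul, one_mul, add_sub_cancel_left]
    have h2 : w * N = 1 - w := by rw [← hwv, mul_add, mul_one, add_sub_cancel_left]
    exact h1.trans h2.symm
  have hw1 : w = 1 + -(N * w) := by
    have : N * w = 1 - w := by rw [← hvw, add_mul, one_mul, add_sub_cancel_left]
    rw [this]; abel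
  have hw1nil : IsNilpotent (-(N * w)) := (hNw.isNilpotent_mul_right hN).neg
  have hYnil : IsNilpotent (N * N * w) := by
    rw [mul_assoc]
    exact ((Commute.refl N).mul_right hNw).isNilpotent_mul_right hN
  have hY0 : N * N * w ≠ 0 := by
    intro h
    apply hsq
    rw [← mul_one (N * N), ← hwv, ← mul_assoc, h, zero_mul]
  obtain ⟨γ, hγ, hne⟩ := hΓ _ (((isGeneric_inv_mulVec h3 hφ ha).mul
    (isGeneric_mulVec h3 hφ ha)).mul (isGeneric_conj h3 hφ ha hYnil hY0))
  obtain ⟨hne, hψY⟩ := mul_ne_zero_iff.1 hne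
  obtain ⟨hψa, hφb⟩ := mul_ne_zero_iff.1 hne
  rw [dotProduct_mulVec] at hψY hψa
  have hTb := hT.conj hγ
  set b := (γ : Matrix ι ι ℤ) *ᵥ a with hb
  set ψ := φ ᵥ* ((γ⁻¹ : SpecialLinearGroup ι ℤ) : Matrix ι ι ℤ) with hψ
  have hψb := hTb.dotProduct_eq
  have hψ0 : ψ ≠ 0 := by rintro h; simp [h] at hψa
  set P := (ψ ⬝ᵥ a) * (φ ⬝ᵥ b) with hP
  have hP0 : P ≠ 0 := mul_ne_zero hψa hφb
  have : NeZero P.natAbs := ⟨by simpa using hP0⟩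
  have hvpow : ∀ k : ℕ, ((v ^ k : SpecialLinearGroup ι ℤ) : Matrix ι ι ℤ) = (1 + N) ^ k :=
      fun k => by
    rw [Matrix.SpecialLinearGroup.coe_pow, hvN]
  have hwpow : ∀ k : ℕ, (((v ^ k)⁻¹ : SpecialLinearGroup ι ℤ) : Matrix ι ι ℤ) = w ^ k := fun k => by
    rw [← inv_pow, Matrix.SpecialLinearGroup.coe_pow]
  obtain ⟨m₀, hm₀, -, hm₀K⟩ := Subgroup.exists_pow_mem_of_index_ne_zero
    (H := congruence ι P.natAbs) Subgroup.FiniteIndex.index_ne_zero v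
  obtain ⟨Q₁, hQ₁⟩ := exists_polynomial_pow hN ψ b
  obtain ⟨Q₂, hQ₂⟩ := exists_polynomial_pow hw1nil ψ b
  rw [← hw1] at hQ₂
  have hQ : Q₁ + Q₂ ≠ 0 := by
    intro h
    have h1 := congr_arg (Polynomial.eval ((1 : ℕ) : ℚ)) h
    rw [Polynomial.eval_add, ← hQ₁, ← hQ₂, Polynomial.eval_zero, pow_one, pow_one] at h1
    have h2 : ψ ⬝ᵥ (1 + N) *ᵥ b + ψ ⬝ᵥ w *ᵥ b = 0 := by exact_mod_cast h1
    refine hψY ?_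
    have h3 : N * N * w = (1 + N) + w - 2 • 1 := by
      have h4 : N * w = 1 - w := by rw [← hvw, add_mul, one_mul, add_sub_cancel_left]
      rw [mul_assoc, h4, mul_sub, h4, mul_one]
      abel
    rw [h3, sub_mulVec, add_mulVec, dotProduct_sub, dotProduct_add, h2, smul_mulVec, one_mulVec,
      dotProduct_smul, hψb]
    simp
  obtain ⟨k, hk⟩ : ∃ k : ℕ, (Q₁ + Q₂).eval ((m₀ * k : ℕ) : ℚ) ≠ 0 := by
    by_contra! h
    refine hQ (Polynomial.eq_zero_of_infinite_isRoot _ ?_)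
    refine (Set.infinite_range_of_injective (f := fun k : ℕ => ((m₀ * k : ℕ) : ℚ)) ?_).mono ?_
    · intro i j hij
      simpa [hm₀.ne'] using hij
    · rintro _ ⟨k, rfl⟩
      exact h k
  set m := m₀ * k with hm
  rw [Polynomial.eval_add, ← hQ₁, ← hQ₂] at hk
  have hk' : ψ ⬝ᵥ (1 + N) ^ m *ᵥ b + ψ ⬝ᵥ w ^ m *ᵥ b ≠ 0 := by exact_mod_cast hk
  obtain ⟨M, hM⟩ := mem_congruence.1
    (show v ^ m ∈ congruence ι P.natAbs by rw [hm, pow_mul]; exact pow_mem hm₀K k)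
  obtain ⟨s, hs⟩ : P ∣ ψ ⬝ᵥ (1 + N) ^ m *ᵥ b := by
    rw [← hvpow, hM, add_mulVec, one_mulVec, dotProduct_add, hψb, zero_add, smul_mulVec,
      dotProduct_smul, smul_eq_mul]
    exact (Int.dvd_natAbs_self (a := P)).mul_right _
  obtain ⟨g, hg, hgs⟩ := hT.smul_right (-s)
  have hginv : ((g⁻¹ : SpecialLinearGroup ι ℤ) : Matrix ι ι ℤ) = 1 - vecMulVec a (-s • φ) :=
    coe_inv_of_eq hgs (vecMulVec_mul_self (hT.smul_right (-s)).dotProduct_eq)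
  have hφv : ∀ k : ℕ, φ ᵥ* (1 + N) ^ k = φ := by
    intro k
    induction k with
    | zero => simp
    | succ k ih => rw [pow_succ, ← vecMul_vecMul, ih, vecMul_add, vecMul_one, hφN, add_zero]
  have hwa₁ : w *ᵥ a = a := by
    conv_rhs => rw [← one_mulVec a, ← hwv, ← mulVec_mulVec, add_mulVec, one_mulVec, hNa, add_zero]
  have hwa : ∀ k : ℕ, w ^ k *ᵥ a = a := by
    intro k
    induction k with
    | zero => simp
    | succ k ih =>
      rw [pow_succ, ← mulVec_mulVec, hwa₁, ih]
  have hTy := hTb.conj (mul_mem hg (pow_mem hv m))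
  refine ⟨_, hTy.pair hTb ?_ hψ0 ?_ ?_⟩
  · intro h
    have h1 := inv_mulVec_mulVec (g * v ^ m) b
    rw [h, mulVec_zero] at h1
    rw [← h1, dotProduct_zero] at hφb
    exact hφb rfl
  · rw [Matrix.SpecialLinearGroup.coe_mul, hgs, hvpow, ← mulVec_mulVec, add_mulVec, one_mulVec,
      vecMulVec_mulVec, dotProduct_add, hs, smul_dotProduct, dotProduct_mulVec φ, hφv]
    simp [hP]
    ring
  · rw [_root_.mul_inv_rev, Matrix.SpecialLinearGroup.coe_mul, hginv, hwpow, ← dotProduct_mulVec,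
      ← mulVec_mulVec, sub_mulVec, one_mulVec, vecMulVec_mulVec_eq_smul, mulVec_sub,
      smul_dotProduct, dotProduct_sub, mulVec_smul, hwa, dotProduct_smul]
    intro h
    refine hk' ?_
    rw [hs, ← h]
    simp [hP]
    ring

end Pair

section SquareZero

variable {ι : Type*} [Fintype ι] [DecidableEq ι] {Γ : Subgroup (SpecialLinearGroup ι ℤ)}
  {a φ : ι → ℤ}

lemma HasTransvection.conj_mul_conj {b ψ : ι → ℤ} (h : HasTransvection Γ b ψ)
    {S : Matrix ι ι ℤ} (hS : HasOneAdd Γ S) (hS2 : S * S = 0) (h0 : ψ ⬝ᵥ S *ᵥ b = 0) :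
    HasTransvection Γ (S *ᵥ b) ((2 : ℤ) • ψ ᵥ* S) := by
  obtain ⟨g, hg, e⟩ := hS
  have e' := coe_inv_of_eq e hS2
  have h1 := h.conj hg
  have h2 := h.conj (inv_mem hg)
  rw [inv_inv] at h2
  rw [e, e', add_mulVec, one_mulVec, vecMul_sub, vecMul_one] at h1
  rw [e, e', sub_mulVec, one_mulVec, vecMul_add, vecMul_one] at h2
  have hb := h.dotProduct_eq
  have h0' : (ψ ᵥ* S) ⬝ᵥ b = 0 := by rw [← dotProduct_mulVec, h0]
  have h00 : (ψ ᵥ* S) ⬝ᵥ (S *ᵥ b) = 0 := by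
    rw [← dotProduct_mulVec, mulVec_mulVec, hS2, zero_mulVec, dotProduct_zero]
  have h3 : HasOneAdd Γ ((-2 : ℤ) • vecMulVec b ψ) :=
    HasOneAdd.zsmul h (vecMulVec_mul_self hb) _
  have h4 := HasOneAdd.add (HasOneAdd.add h1 h2 ?_) h3 ?_
  · have h5 := HasOneAdd.neg h4 ?_
    · rw [HasTransvection]
      convert h5 using 1
      simp only [add_vecMulVec, sub_vecMulVec, vecMulVec_add, vecMulVec_sub, vecMulVec_smul]
      module
    · simp only [add_mul, mul_add, vecMulVec_mul_vecMulVec, smul_mul_assoc, mul_smul_comm,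
        dotProduct_add, add_dotProduct, dotProduct_sub, sub_dotProduct, h0, h0', h00, hb]
      simp
  · simp only [vecMulVec_mul_vecMulVec, dotProduct_sub, sub_dotProduct, h0, h0', h00, hb]
    simp
  · simp only [add_mul, vecMulVec_mul_vecMulVec, mul_smul_comm,
        add_dotProduct, sub_dotProduct, h0', hb]
    simp

lemma HasTransvection.of_sq_eq_zero {b ψ : ι → ℤ} (hT : HasTransvection Γ a φ)
    {N : Matrix ι ι ℤ} (hN : HasOneAdd Γ N) (hN2 : N * N = 0) (hNa : N *ᵥ a = 0)
    (hφN : φ ᵥ* N = 0) (h : HasTransvection Γ b ψ) :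
    HasTransvection Γ ((ψ ⬝ᵥ N *ᵥ b) • a - (ψ ⬝ᵥ a) • N *ᵥ b)
      ((2 * (φ ⬝ᵥ b) * (ψ ⬝ᵥ a)) • ((ψ ⬝ᵥ N *ᵥ b) • φ - (φ ⬝ᵥ b) • ψ ᵥ* N)) := by
  have haφ := vecMulVec_mul_self hT.dotProduct_eq
  set s := ψ ⬝ᵥ N *ᵥ b with hs
  set m := -((ψ ⬝ᵥ a) * (φ ⬝ᵥ b)) with hm
  have h1 : HasOneAdd Γ (s • vecMulVec a φ + m • N) := by
    refine HasOneAdd.add (HasOneAdd.zsmul hT haφ _) (hN.zsmul hN2 _) ?_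
    rw [smul_mul_assoc, mul_smul_comm, vecMulVec_mul, hφN]
    simp
  have hSb : (s • vecMulVec a φ + m • N) *ᵥ b =
      (φ ⬝ᵥ b) • (s • a - (ψ ⬝ᵥ a) • N *ᵥ b) := by
    rw [add_mulVec, smul_mulVec, smul_mulVec, vecMulVec_mulVec_eq_smul]
    ext i
    simp [hm]
    ring
  have hψS : ψ ᵥ* (s • vecMulVec a φ + m • N) =
      (ψ ⬝ᵥ a) • (s • φ - (φ ⬝ᵥ b) • ψ ᵥ* N) := by
    rw [vecMul_add, vecMul_smul, vecMul_smul, vecMul_vecMulVec]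
    ext i
    simp [hm]
    ring
  have h2 := h.conj_mul_conj h1 ?_ ?_
  · rw [hSb, hψS] at h2
    rw [HasTransvection] at h2 ⊢
    convert h2 using 1
    ext i j
    simp [vecMulVec_apply]
    ring
  · simp only [add_mul, mul_add, smul_mul_assoc, mul_smul_comm, haφ, hN2, vecMulVec_mul,
      mul_vecMulVec, hφN, hNa]
    simp
  · rw [hSb, dotProduct_smul, dotProduct_sub, dotProduct_smul, dotProduct_smul, ← hs]
    simp
    right
    ring

lemma HasTransvection.oneAdd_add {b ψ c χ : ι → ℤ} (hT : HasTransvection Γ a φ)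
    (hT' : HasTransvection Γ c χ) (hφc : φ ⬝ᵥ c = 0) (hχa : χ ⬝ᵥ a = 0)
    (h : HasTransvection Γ b ψ) :
    HasOneAdd Γ ((2 * (φ ⬝ᵥ b) * (ψ ⬝ᵥ a) * (χ ⬝ᵥ b) * (ψ ⬝ᵥ c)) •
      (((φ ⬝ᵥ b) * (ψ ⬝ᵥ c)) • vecMulVec a χ + ((χ ⬝ᵥ b) * (ψ ⬝ᵥ a)) • vecMulVec c φ)) := by
  have hφa := hT.dotProduct_eq
  have hχc := hT'.dotProduct_eq
  have h1 := hT.of_sq_eq_zero hT' (vecMulVec_mul_self hχc)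
    (by rw [vecMulVec_mulVec_eq_smul, hχa, zero_smul])
    (by rw [vecMul_vecMulVec, hφc, zero_smul]) h
  rw [vecMulVec_mulVec_eq_smul, vecMul_vecMulVec, dotProduct_smul, smul_eq_mul] at h1
  set α := φ ⬝ᵥ b
  set β := χ ⬝ᵥ b
  set α' := ψ ⬝ᵥ a
  set β' := ψ ⬝ᵥ c
  have h2 := HasOneAdd.zsmul hT (vecMulVec_mul_self hφa) (2 * α * α' * β * β' * (β' * β))
  have h3 := HasOneAdd.zsmul hT' (vecMulVec_mul_self hχc) (2 * α * α' * β * β' * (α' * α))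
  have h4 := HasOneAdd.zsmul h1 (vecMulVec_mul_self h1.dotProduct_eq) (-1)
  have h5 := (h2.add h3 ?_).add h4 ?_
  · convert h5 using 1
    simp only [sub_vecMulVec, vecMulVec_sub, vecMulVec_smul, smul_vecMulVec]
    module
  all_goals
    simp only [add_mul, vecMulVec_mul_vecMulVec, mul_smul_comm, smul_mul_assoc, dotProduct_sub,
      dotProduct_smul, hφa, hφc, hχa, hχc]
    simp

lemma HasTransvection.pair_of_orthogonal (hΓ : MeetsGeneric Γ) (h3 : 3 ≤ Fintype.card ι)
    {c χ : ι → ℤ} (hT : HasTransvection Γ a φ) (hT' : HasTransvection Γ c χ) (ha : a ≠ 0)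
    (hc : c ≠ 0) (hφχ : Indep φ χ) (hφc : φ ⬝ᵥ c = 0) (hχa : χ ⬝ᵥ a = 0) :
    HasTransvectionPair Γ a := by
  have hφa := hT.dotProduct_eq
  have hχc := hT'.dotProduct_eq
  have hφ := hφχ.symm.right_ne_zero
  have hχ := hφχ.right_ne_zero
  have hgen := ((isGeneric_mulVec h3 hφ ha).mul (isGeneric_mulVec h3 hχ ha)).mul
    ((isGeneric_inv_mulVec h3 hφ ha).mul (isGeneric_inv_mulVec h3 hφ hc))
  obtain ⟨γ₁, hγ₁, hne₁⟩ := hΓ _ hgen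
  have hb₁ := hT.oneAdd_add hT' hφc hχa (hT.conj hγ₁)
  rw [← dotProduct_mulVec, ← dotProduct_mulVec] at hb₁
  obtain ⟨h1, h2⟩ := mul_ne_zero_iff.1 hne₁
  obtain ⟨hα₁, hβ₁⟩ := mul_ne_zero_iff.1 h1
  obtain ⟨hα₁', hβ₁'⟩ := mul_ne_zero_iff.1 h2
  clear h1 h2 hne₁
  set α₁ := φ ⬝ᵥ (γ₁ : Matrix ι ι ℤ) *ᵥ a
  set β₁ := χ ⬝ᵥ (γ₁ : Matrix ι ι ℤ) *ᵥ a
  set α₁' := φ ⬝ᵥ ((γ₁⁻¹ : SpecialLinearGroup ι ℤ) : Matrix ι ι ℤ) *ᵥ a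
  set β₁' := φ ⬝ᵥ ((γ₁⁻¹ : SpecialLinearGroup ι ℤ) : Matrix ι ι ℤ) *ᵥ c
  obtain ⟨γ₂, hγ₂, hne₂⟩ := hΓ _ (hgen.mul (isGeneric_ratio h3 (c := c) hφχ ha (β₁ * α₁')
    (mul_ne_zero hα₁ hβ₁') hφa hχa))
  have hb₂ := hT.oneAdd_add hT' hφc hχa (hT.conj hγ₂)
  rw [← dotProduct_mulVec, ← dotProduct_mulVec] at hb₂
  obtain ⟨hne₂, hratio⟩ := mul_ne_zero_iff.1 hne₂
  obtain ⟨h1, h2⟩ := mul_ne_zero_iff.1 hne₂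
  obtain ⟨hα₂, hβ₂⟩ := mul_ne_zero_iff.1 h1
  obtain ⟨hα₂', hβ₂'⟩ := mul_ne_zero_iff.1 h2
  clear h1 h2 hne₂
  set α₂ := φ ⬝ᵥ (γ₂ : Matrix ι ι ℤ) *ᵥ a
  set β₂ := χ ⬝ᵥ (γ₂ : Matrix ι ι ℤ) *ᵥ a
  set α₂' := φ ⬝ᵥ ((γ₂⁻¹ : SpecialLinearGroup ι ℤ) : Matrix ι ι ℤ) *ᵥ a
  set β₂' := φ ⬝ᵥ ((γ₂⁻¹ : SpecialLinearGroup ι ℤ) : Matrix ι ι ℤ) *ᵥ c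
  set κ₁ := 2 * α₁ * α₁' * β₁ * β₁' with hκ₁
  set κ₂ := 2 * α₂ * α₂' * β₂ * β₂' with hκ₂
  have hκ₁0 : κ₁ ≠ 0 := by simp [*]
  have hκ₂0 : κ₂ ≠ 0 := by simp [*]
  have hsq : ∀ p q r s k l : ℤ, (k • (p • vecMulVec a χ + q • vecMulVec c φ)) *
      (l • (r • vecMulVec a χ + s • vecMulVec c φ)) = 0 := by
    intro p q r s k l
    simp only [add_mul, mul_add, vecMulVec_mul_vecMulVec, mul_smul_comm, smul_mul_assoc,
      hφa, hφc, hχa, hχc]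
    simp
  have h := (hb₁.zsmul (hsq _ _ _ _ _ _) (-(κ₂ * (β₂ * α₂')))).add
    (hb₂.zsmul (hsq _ _ _ _ _ _) (κ₁ * (β₁ * α₁'))) (by
      rw [smul_mul_assoc, mul_smul_comm, hsq, smul_zero, smul_zero])
  refine ⟨ha, φ, _, hφχ.smul_right (k := κ₁ * κ₂ *
    ((β₁ * α₁') * (α₂ * β₂') - (α₁ * β₁') * (α₂' * β₂)))
    (mul_ne_zero (mul_ne_zero hκ₁0 hκ₂0) hratio), hT, ?_⟩
  rw [HasTransvection]
  convert h using 1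
  simp only [vecMulVec_smul]
  module

lemma exists_pair_of_sq_eq_zero (hΓ : MeetsGeneric Γ) (h3 : 3 ≤ Fintype.card ι) (ha : a ≠ 0)
    (hφ : φ ≠ 0) (hT : HasTransvection Γ a φ) {N : Matrix ι ι ℤ} (hN : HasOneAdd Γ N)
    (hN2 : N * N = 0) (hNa : N *ᵥ a = 0) (hφN : φ ᵥ* N = 0)
    (hindep : ∀ k l : ℤ, k • N = l • vecMulVec a φ → k = 0) :
    ∃ y, HasTransvectionPair Γ y := by
  by_cases h1 : ∃ x, Indep a (N *ᵥ x)
  swap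
  · obtain ⟨i, hi⟩ := Function.ne_iff.1 ha
    have hrow : a i • N = vecMulVec a (N i) := by
      ext j k
      by_contra h
      refine h1 ⟨Pi.single k 1, i, j, ?_⟩
      simpa [vecMulVec_apply] using h
    refine ⟨a, ha, φ, N i, ?_, hT, ?_⟩
    · by_contra h
      obtain ⟨k, hk⟩ := Function.ne_iff.1 hφ
      refine mul_ne_zero hk hi (hindep (φ k * a i) (N i k) ?_)
      rw [mul_smul, hrow]
      ext p q
      have : φ k * N i q = φ q * N i k := by
        by_contra h'
        exact h ⟨k, q, h'⟩
      simp only [Matrix.smul_apply, vecMulVec_apply, smul_eq_mul]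
      linear_combination a p * this
    · rw [HasTransvection, ← hrow]
      exact hN.zsmul hN2 _
  by_cases h2 : ∃ η, Indep φ (η ᵥ* N)
  swap
  · obtain ⟨j, hj⟩ := Function.ne_iff.1 hφ
    have hcol : φ j • N = vecMulVec (N.col j) φ := by
      ext i k
      by_contra h
      refine h2 ⟨Pi.single i 1, j, k, ?_⟩
      simpa [vecMulVec_apply, mul_comm] using h
    have hTx : HasTransvection Γ (N.col j) φ := by
      rw [HasTransvection, ← hcol]
      exact hN.zsmul hN2 _
    have hax : Indep a (N.col j) := by
      obtain ⟨x, hx⟩ := h1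
      have h := congr_arg (· *ᵥ x) hcol
      simp only [smul_mulVec, vecMulVec_mulVec_eq_smul] at h
      obtain ⟨p, q, hpq⟩ := hx
      refine ⟨p, q, fun h' => hpq (mul_left_cancel₀ hj ?_)⟩
      have hp := congr_fun h p
      have hq := congr_fun h q
      simp only [Pi.smul_apply, smul_eq_mul] at hp hq
      linear_combination a p * hq - a q * hp + (φ ⬝ᵥ x) * h'
    set x := N.col j
    obtain ⟨γ, hγ, hne⟩ := hΓ _ ((isGeneric_mulVec h3 hφ ha).mul (isGeneric_inv_mulVec h3 hφ ha))
    obtain ⟨hb, hψ⟩ := mul_ne_zero_iff.1 hne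
    have hTb := hT.conj hγ
    rw [dotProduct_mulVec] at hψ
    set b := (γ : Matrix ι ι ℤ) *ᵥ a
    set ψ := φ ᵥ* ((γ⁻¹ : SpecialLinearGroup ι ℤ) : Matrix ι ι ℤ)
    have hz : HasTransvection Γ ((ψ ⬝ᵥ x) • a - (ψ ⬝ᵥ a) • x) φ :=
      mem_vectors.1 (sub_mem (zsmul_mem (mem_vectors.2 hT) _) (zsmul_mem (mem_vectors.2 hTx) _))
    refine ⟨_, hz.pair hTb (hax.smul_sub_smul _ hψ).right_ne_zero ?_ ?_ hb⟩
    · intro h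
      simp [h] at hψ
    · simp only [dotProduct_sub, dotProduct_smul, smul_eq_mul]
      ring
  obtain ⟨x, i, j, hx⟩ := h1
  obtain ⟨η, k, l, hη⟩ := h2
  have hℓ : a i • N j - a j • N i ≠ 0 := by
    intro h
    have := congr_arg (· ⬝ᵥ x) h
    simp only [sub_dotProduct, smul_dotProduct, zero_dotProduct, smul_eq_mul] at this
    exact hx (sub_eq_zero.1 this)
  have hz : φ k • N.col l - φ l • N.col k ≠ 0 := by
    intro h
    have := congr_arg (η ⬝ᵥ ·) h
    simp only [dotProduct_sub, dotProduct_smul, dotProduct_zero, smul_eq_mul] at this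
    exact hη (sub_eq_zero.1 this)
  obtain ⟨γ, hγ, hne⟩ := hΓ _ (((isGeneric_mulVec h3 hφ ha).mul
    (isGeneric_inv_mulVec h3 hφ ha)).mul
    ((isGeneric_mulVec h3 hℓ ha).mul (isGeneric_inv_mulVec h3 hφ hz)))
  obtain ⟨h1, h2⟩ := mul_ne_zero_iff.1 hne
  obtain ⟨hb, hψ⟩ := mul_ne_zero_iff.1 h1
  obtain ⟨hNb, hψN⟩ := mul_ne_zero_iff.1 h2
  have hTb := hT.conj hγ
  rw [dotProduct_mulVec] at hψ hψN
  set b := (γ : Matrix ι ι ℤ) *ᵥ a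
  set ψ := φ ᵥ* ((γ⁻¹ : SpecialLinearGroup ι ℤ) : Matrix ι ι ℤ)
  have hNb : Indep a (N *ᵥ b) := by
    refine ⟨i, j, fun h => hNb ?_⟩
    simp only [sub_dotProduct, smul_dotProduct, smul_eq_mul]
    simp only [mulVec] at h
    linear_combination h
  have hψN : Indep φ (ψ ᵥ* N) := by
    refine ⟨k, l, fun h => hψN ?_⟩
    simp only [dotProduct_sub, dotProduct_smul, smul_eq_mul]
    exact sub_eq_zero.2 h
  have hφa := hT.dotProduct_eq
  refine ⟨a, hT.pair_of_orthogonal hΓ h3 (hT.of_sq_eq_zero hN hN2 hNa hφN hTb) ha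
    (hNb.smul_sub_smul _ hψ).right_ne_zero
    ((hψN.smul_sub_smul _ hb).smul_right (mul_ne_zero (mul_ne_zero two_ne_zero hb) hψ)) ?_ ?_⟩
  · rw [dotProduct_sub, dotProduct_smul, dotProduct_smul, hφa, dotProduct_mulVec φ, hφN]
    simp
  · rw [smul_dotProduct, sub_dotProduct, smul_dotProduct, smul_dotProduct, hφa,
      ← dotProduct_mulVec ψ, hNa]
    simp

end SquareZero

section Reduction

variable {ι : Type*} [Fintype ι] [DecidableEq ι] {Γ : Subgroup (SpecialLinearGroup ι ℤ)}

lemma coe_zpow_of_sq_eq_zero {g : SpecialLinearGroup ι ℤ} {X : Matrix ι ι ℤ}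
    (hg : (g : Matrix ι ι ℤ) = 1 + X) (hX : X * X = 0) (k : ℤ) :
    ((g ^ k : SpecialLinearGroup ι ℤ) : Matrix ι ι ℤ) = 1 + k • X := by
  have h : ∀ m : ℕ, ((g ^ m : SpecialLinearGroup ι ℤ) : Matrix ι ι ℤ) = 1 + (m : ℤ) • X := by
    intro m
    induction m with
    | zero => simp
    | succ m ih =>
      rw [pow_succ, Matrix.SpecialLinearGroup.coe_mul, ih, hg, mul_add, mul_one, add_mul,
        one_mul, smul_mul_assoc, hX]
      push_cast
      module
  obtain ⟨m, rfl | rfl⟩ := k.eq_nat_or_neg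
  · rw [zpow_natCast, h]
  · rw [_root_.zpow_neg, zpow_natCast,
      coe_inv_of_eq (h m) (by rw [smul_mul_smul_comm, hX, smul_zero]), neg_smul, sub_eq_add_neg]

lemma mulVec_eq_zero_of_isNilpotent {N : Matrix ι ι ℤ} (hN : IsNilpotent N) {x : ι → ℤ} {c d : ℤ}
    (hd : d ≠ 0) (h : d • N *ᵥ x = c • x) : N *ᵥ x = 0 := by
  obtain ⟨r, hr⟩ := hN
  have h1 : ∀ r : ℕ, d ^ r • N ^ r *ᵥ x = c ^ r • x := by
    intro r
    induction r with
    | zero => simp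
    | succ r ih =>
      rw [pow_succ N, ← mulVec_mulVec, pow_succ d, mul_smul, ← mulVec_smul, h, mulVec_smul,
        smul_comm, ih, smul_smul, pow_succ' c]
  have h2 := h1 r
  rw [hr, zero_mulVec, smul_zero] at h2
  rcases smul_eq_zero.1 h2.symm with h3 | h3
  · rw [eq_zero_of_pow_eq_zero h3, zero_smul] at h
    exact (smul_eq_zero.1 h).resolve_left hd
  · rw [h3, mulVec_zero]

lemma finiteIndex_of_oneAdd (hΓ : MeetsGeneric Γ) (h3 : 3 ≤ Fintype.card ι)
    {u v : SpecialLinearGroup ι ℤ} (hu : u ∈ Γ) (hv : v ∈ Γ) {X N : Matrix ι ι ℤ}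
    (huX : (u : Matrix ι ι ℤ) = 1 + X) (hvN : (v : Matrix ι ι ℤ) = 1 + N)
    (hX : IsNilpotent X) (hN : IsNilpotent N) (hrank : ∀ i j k l, X i j * X k l = X k j * X i l)
    (hcomm : u * v = v * u) (hfree : ∀ r s : ℤ, u ^ r * v ^ s = 1 → r = 0 ∧ s = 0) :
    Γ.FiniteIndex := by
  have hXN : X * N = N * X := by
    have h := congr_arg (fun g : SpecialLinearGroup ι ℤ => (g : Matrix ι ι ℤ)) hcomm
    simp only [Matrix.SpecialLinearGroup.coe_mul, huX, hvN, mul_add, add_mul, mul_one, one_mul] at h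
    have h' : 1 + N + X + X * N = 1 + N + X + N * X := by
      rw [← sub_eq_zero] at h ⊢
      rw [← h]
      abel
    exact add_left_cancel h'
  have hX0 : X ≠ 0 := by
    rintro rfl
    refine one_ne_zero (hfree 1 0 ?_).1
    ext i j
    simp [huX]
  have hX2 : X * X = 0 := by
    ext i j
    have h0 : X.trace = 0 := (isNilpotent_trace_of_isNilpotent hX).eq_zero
    have : (X * X) i j = X i j * X.trace := by
      rw [trace, Finset.mul_sum]
      exact Finset.sum_congr rfl fun k _ => by rw [diag_apply, hrank i j k k, mul_comm]
    rw [this, h0, mul_zero, Matrix.zero_apply]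
  obtain ⟨i, j, hij⟩ : ∃ i j, X i j ≠ 0 := by
    by_contra! h
    exact hX0 (ext h)
  set a := X.col j with ha
  set φ := X.row i with hφ
  have hXaφ : X i j • X = vecMulVec a φ := by
    ext k l
    exact hrank i j k l
  have ha0 : a ≠ 0 := fun h => hij (congr_fun h i)
  have hφ0 : φ ≠ 0 := fun h => hij (congr_fun h j)
  have hT : HasTransvection Γ a φ := by
    rw [HasTransvection, ← hXaφ]
    exact HasOneAdd.zsmul ⟨u, hu, huX⟩ hX2 _
  have hcomm' : vecMulVec (N *ᵥ a) φ = vecMulVec a (φ ᵥ* N) := by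
    rw [← mul_vecMulVec, ← vecMulVec_mul, ← hXaφ, mul_smul_comm, smul_mul_assoc, hXN]
  have hNa : N *ᵥ a = 0 := by
    refine mulVec_eq_zero_of_isNilpotent hN (c := (φ ᵥ* N) j) (d := φ j) hij ?_
    ext k
    have := congr_fun₂ hcomm' k j
    simp only [vecMulVec_apply] at this
    simp only [Pi.smul_apply, smul_eq_mul]
    linear_combination this
  have hφN : φ ᵥ* N = 0 := by
    ext l
    have := congr_fun₂ hcomm' i l
    rw [hNa, zero_vecMulVec, vecMulVec_apply] at this
    exact (mul_eq_zero.1 this.symm).resolve_left hij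
  have h3' : ∀ i j : ι, ∃ k, k ≠ i ∧ k ≠ j := by
    intro i j
    obtain ⟨k, hk⟩ := Finset.exists_mem_notMem_of_card_lt_card (s := {i, j})
      (t := (Finset.univ : Finset ι)) (Finset.card_le_two.trans_lt h3)
    exact ⟨k, by simpa using hk⟩
  obtain ⟨y, hy⟩ : ∃ y, HasTransvectionPair Γ y := by
    by_cases hN2 : N * N = 0
    · refine exists_pair_of_sq_eq_zero hΓ h3 ha0 hφ0 hT ⟨v, hv, hvN⟩ hN2 hNa hφN fun k l h => ?_
      refine (hfree (-(l * X i j)) k ?_).2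
      rw [_root_.zpow_neg, inv_mul_eq_one]
      ext1
      rw [coe_zpow_of_sq_eq_zero huX hX2, coe_zpow_of_sq_eq_zero hvN hN2, h, mul_smul, hXaφ]
    · exact exists_pair_of_sq_ne_zero hΓ h3 ha0 hφ0 hT hv hvN hN hNa hφN hN2
  exact hy.finiteIndex hΓ h3 h3'

end Reduction

section ZariskiDense

variable {n : ℕ} {Γ : Subgroup (SLZ n)}

lemma meetsGeneric_of_zariskiDense (hZ : ZariskiDense Γ) : MeetsGeneric Γ := by
  rintro f ⟨p, hp, hpf, M, hM⟩
  by_contra! h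
  obtain ⟨P, hP⟩ := mem_polyFun_iff.1 hp
  have hcast : ∀ A : Matrix (Fin n) (Fin n) ℚ, MvPolynomial.aeval
      (fun q : Fin n × Fin n => ((A q.1 q.2 : ℚ) : ℂ)) P = ((p A : ℚ) : ℂ) := by
    intro A
    rw [hP]
    exact MvPolynomial.aeval_algebraMap_apply ℂ (fun q : Fin n × Fin n => A q.1 q.2) P
  refine hM ?_
  have h1 := hZ P (fun g hg => ?_) ((M : Matrix (Fin n) (Fin n) ℚ).map (Rat.castHom ℂ)) ?_
  · have h2 := hcast M
    simp only [Matrix.map_apply, Rat.coe_castHom] at h1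
    rw [h1] at h2
    exact_mod_cast h2.symm
  · have h2 := hcast ((g : Matrix (Fin n) (Fin n) ℤ).map (Int.castRingHom ℚ))
    rw [hpf, h g hg] at h2
    simpa using h2
  · rw [← RingHom.mapMatrix_apply, ← RingHom.map_det, M.det_coe, map_one]

lemma matQ_sub_one (g : SLZ n) :
    matQ g - 1 = (Int.castRingHom ℚ).mapMatrix ((g : Matrix (Fin n) (Fin n) ℤ) - 1) := by
  rw [map_sub, map_one]
  rfl

lemma isNilpotent_sub_one {g : SLZ n} (h : IsNilpotent (linQ g)) :
    IsNilpotent ((g : Matrix (Fin n) (Fin n) ℤ) - 1) := by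
  have h1 : IsNilpotent (matQ g - 1) := (isNilpotent_toLin'_iff _).1 h
  rw [matQ_sub_one] at h1
  exact (IsNilpotent.map_iff (f := (Int.castRingHom ℚ).mapMatrix)
    (Matrix.map_injective Int.cast_injective)).1 h1

lemma mul_eq_mul_of_isR1U {u : SLZ n} (h : IsR1U u) (i j k l : Fin n) :
    ((u : Matrix (Fin n) (Fin n) ℤ) - 1) i j * ((u : Matrix (Fin n) (Fin n) ℤ) - 1) k l =
      ((u : Matrix (Fin n) (Fin n) ℤ) - 1) k j * ((u : Matrix (Fin n) (Fin n) ℤ) - 1) i l := by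
  obtain ⟨⟨w, hw⟩, -, hspan⟩ := finrank_eq_one_iff'.1 h.2
  have hcol : ∀ j, ∃ c : ℚ, ∀ i, c * w i = (((u : Matrix (Fin n) (Fin n) ℤ) - 1) i j : ℤ) := by
    intro j
    obtain ⟨c, hc⟩ := hspan ⟨linQ u (Pi.single j 1), LinearMap.mem_range_self _ _⟩
    refine ⟨c, fun i => ?_⟩
    have : (c • w) i = linQ u (Pi.single j 1) i := congr_fun (congr_arg Subtype.val hc) i
    simp only [linQ, matQ_sub_one] at this
    simpa using this
  obtain ⟨c, hc⟩ := hcol j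
  obtain ⟨d, hd⟩ := hcol l
  have : ((((u : Matrix (Fin n) (Fin n) ℤ) - 1) i j *
        ((u : Matrix (Fin n) (Fin n) ℤ) - 1) k l : ℤ) : ℚ) =
      (((u : Matrix (Fin n) (Fin n) ℤ) - 1) k j *
        ((u : Matrix (Fin n) (Fin n) ℤ) - 1) i l : ℤ) := by
    push_cast
    rw [← hc, ← hd, ← hc, ← hd]
    ring
  exact_mod_cast this

lemma ProfinitelyDense.eq_top {G : Type*} [Group G] {H : Subgroup G} (h : ProfinitelyDense H)
    [H.FiniteIndex] : H = ⊤ := by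
  rw [← h H.normalCore inferInstance inferInstance, sup_eq_left.2 H.normalCore_le]

end ZariskiDense

end Venkataramana

/-- Theorem 2.7 (Venkataramana): if a Zariski-dense `Γ ≤ SL(n,ℤ)` contains a rank-1
unipotent `u` and a unipotent `v` with `⟨u, v⟩ ≅ ℤ²`, then `Γ` has finite index;
in particular if `Γ` is profinitely dense then `Γ = SL(n,ℤ)`. -/
theorem venkataramana (n : ℕ) (hn : 3 ≤ n) (Γ : Subgroup (SLZ n))
    (hZ : ZariskiDense Γ) (u v : SLZ n) (hu : u ∈ Γ) (hv : v ∈ Γ)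
    (huU : IsR1U u) (hvU : IsNilpotent (linQ v))
    (hcomm : u * v = v * u)
    (hfree : ∀ r s : ℤ, u ^ r * v ^ s = 1 → r = 0 ∧ s = 0) :
    Γ.FiniteIndex ∧ (ProfinitelyDense Γ → Γ = ⊤) := by
  have : Γ.FiniteIndex := Venkataramana.finiteIndex_of_oneAdd
    (Venkataramana.meetsGeneric_of_zariskiDense hZ) (by simpa using hn) hu hv
    (add_sub_cancel _ _).symm (add_sub_cancel _ _).symm
    (Venkataramana.isNilpotent_sub_one huU.1) (Venkataramana.isNilpotent_sub_one hvU)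
    (Venkataramana.mul_eq_mul_of_isR1U huU) hcomm hfree
  exact ⟨this, fun h => Venkataramana.ProfinitelyDense.eq_top h⟩
end
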